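/- Existence of infinite-volume measures for the conditioned massive GFF: let d ≥ 2, N ∈ ℕ, m² > 0, R > 0, and I = B^N(0,R) ⊆ ℝ^N. The sequence of probability measures (P_{ℤ^d,m²}[ · | Ω^I_{Λ_n}])_n is tight, and all its subsequential weak limits lie in 𝒢_1(𝒰^I); in particular, 𝒢_1(𝒰^I) is non-empty. Moreover, there exists C = C(m², R, d, N) > 0 such that sup_{x ∈ ℤ^d} sup_n E_{ℤ^d,m²}[ |ψ(x)| | Ω^I_{Λ_n} ] ≤ C. -/

import Mathlib

open MeasureTheory Real Filter Asymptotics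
open scoped ENNReal NNReal Classical BigOperators

noncomputable section

abbrev Site : Type := ℤ × ℤ

abbrev Spin (N : ℕ) : Type := EuclideanSpace ℝ (Fin N)

abbrev Conf (N : ℕ) : Type := Site → Spin N

/-- `Λ_n = [-n/2, n/2]² ∩ ℤ²`. -/
def Lam (n : ℕ) : Finset Site :=
  (Finset.Icc (-(n : ℤ)) (n : ℤ) ×ˢ Finset.Icc (-(n : ℤ)) (n : ℤ)).filter
    (fun x => 2 * |x.1| ≤ (n : ℤ) ∧ 2 * |x.2| ≤ (n : ℤ))

/-- extension of a configuration on `Λ_n` by zero (Dirichlet boundary condition). -/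
def extZero (n : ℕ) {N : ℕ} (ω : {x // x ∈ Lam n} → Spin N) : Conf N :=
  fun x => if h : x ∈ Lam n then ω ⟨x, h⟩ else 0

/-- Dirichlet energy `(1/(8π)) Σ_{x∼y} |φ(x) - φ(y)|²`, i.e. coupling `𝔤 = 1/(2π)`;
the sum over the enlarged box `Λ_{n+4}` covers all nearest-neighbour edges meeting
`Λ_n ∪ ∂Λ_n` (edges not meeting `Λ_n` contribute `0` since `φ ≡ 0` there). -/
def dirEnergy (n N : ℕ) (φ : Conf N) : ℝ :=
  (1 / (8 * π)) *
    ∑ x ∈ Lam (n + 4), (‖φ x - φ (x + ((1 : ℤ), (0 : ℤ)))‖ ^ 2 +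
      ‖φ x - φ (x + ((0 : ℤ), (1 : ℤ)))‖ ^ 2)

def gffAux (n N : ℕ) : Measure ({x // x ∈ Lam n} → Spin N) :=
  (Measure.pi fun _ => (volume : Measure (Spin N))).withDensity
    (fun ω => ENNReal.ofReal (Real.exp (- dirEnergy n N (extZero n ω))))

/-- The law `P_n` of the `N`-vectorial Dirichlet GFF on `Λ_n`, viewed as a probability
measure on full configurations (extended by `0` outside `Λ_n`). -/
def gff (n N : ℕ) : Measure (Conf N) :=
  (gffAux n N Set.univ)⁻¹ • (gffAux n N).map (extZero n)

/-- conditional probability `μ[A | B]`. -/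
def condProb {α : Type*} [MeasurableSpace α] (μ : Measure α) (B A : Set α) : ℝ≥0∞ :=
  μ (A ∩ B) / μ B

/-- conditional expectation `E_μ[f | B]`. -/
def condExpOn {α : Type*} [MeasurableSpace α] (μ : Measure α) (B : Set α) (f : α → ℝ) : ℝ :=
  (∫ x in B, f x ∂μ) / (μ B).toReal

/-- `Λ = [-1/2,1/2]²`. -/
def unitSq : Set (ℝ × ℝ) := Set.Icc (-(1/2 : ℝ), -(1/2 : ℝ)) (1/2, 1/2)

/-- `D_n = (nD) ∩ ℤ²`. -/
def Dn (D : Set (ℝ × ℝ)) (n : ℕ) : Set Site :=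
  {x | ((x.1 : ℝ) / n, (x.2 : ℝ) / n) ∈ D}

/-- the event `Ω^I_V = {φ(x) ∉ I ∀ x ∈ V}`. -/
def avoids {N : ℕ} (V : Set Site) (I : Set (Spin N)) : Set (Conf N) :=
  {φ | ∀ x ∈ V, φ x ∉ I}

/-- the closest even integer to `n^α`. -/
def evenSide (n : ℕ) (α : ℝ) : ℤ := 2 * round ((n : ℝ) ^ α / 2)

/-- the discrete box of side length `a` centered at `c`. -/
def boxAt (a : ℤ) (c : Site) : Set Site :=
  {y | 2 * |y.1 - c.1| ≤ a ∧ 2 * |y.2 - c.2| ≤ a}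

/-- the inner boundary of the discrete box of side length `a` centered at `c`. -/
def innerBdryAt (a : ℤ) (c : Site) : Set Site :=
  {y | y ∈ boxAt a c ∧ (2 * |y.1 - c.1| = a ∨ 2 * |y.2 - c.2| = a)}

/-- `c` is a center of a box of `Π_α(x₀)`. -/
def isCenter (D : Set (ℝ × ℝ)) (n : ℕ) (α : ℝ) (x0 : Site) (c : Site) : Prop :=
  (∃ k l : ℤ, c = x0 + (k * evenSide n α, l * evenSide n α)) ∧
    boxAt (evenSide n α) c ⊆ Dn D n

/-- the centers of the boxes of `Π_α(x₀)`, as a finite set. -/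
def centersF (D : Set (ℝ × ℝ)) (n : ℕ) (α : ℝ) (x0 : Site) : Finset Site :=
  (Lam n).filter (fun c => isCenter D n α x0 c)

/-- `⨅_α(x₀)`, the union of the inner boundaries of the boxes of `Π_α(x₀)`. -/
def gridK (D : Set (ℝ × ℝ)) (n : ℕ) (α : ℝ) (x0 : Site) : Set Site :=
  ⋃ c ∈ centersF D n α x0, innerBdryAt (evenSide n α) c

/-- the σ-algebra generated by the coordinates in `K`. -/
def mGrid (N : ℕ) (K : Set Site) : MeasurableSpace (Conf N) :=
  MeasurableSpace.comap (fun φ (y : K) => φ y) inferInstance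

/-- the harmonic extension `h^K(c) = E[φ(c) | F_K]` as a random variable. -/
def harmExt (n N : ℕ) (K : Set Site) (c : Site) : Conf N → Spin N :=
  (gff n N)[fun ψ => ψ c | mGrid N K]

/-- covariance of two real random variables. -/
def covar {α : Type*} [MeasurableSpace α] (μ : Measure α) (X Y : α → ℝ) : ℝ :=
  ∫ ω, (X ω - ∫ ω', X ω' ∂μ) * (Y ω - ∫ ω', Y ω' ∂μ) ∂μ

abbrev SiteD (d : ℕ) : Type := Fin d → ℤ

abbrev ConfD (d N : ℕ) : Type := SiteD d → Spin N

/-- the unit lattice vector in direction `e`. -/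
def unitv (d : ℕ) (e : Fin d) : SiteD d := fun i => if i = e then 1 else 0

/-- the sum of the spins at the `2d` neighbours of `x`. -/
def nbrSum {d N : ℕ} (ψ : ConfD d N) (x : SiteD d) : Spin N :=
  ∑ e : Fin d, (ψ (x + unitv d e) + ψ (x - unitv d e))

/-- the unnormalized single-site Gibbs weight at `x` given the configuration `ψ` off `x`,
for the potential `U_{{x}}(γ) = ((2d+m²)/2)|γ|² + ∞·1_{γ ∈ I}`,
`U_{{x,y}} = -γ·ψ(y)` for `y ∼ x`. -/
def ssWeight (d N : ℕ) (m2 : ℝ) (I : Set (Spin N)) (ψ : ConfD d N) (x : SiteD d)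
    (γ : Spin N) : ℝ :=
  if γ ∈ I then 0
  else Real.exp (-((2 * d + m2) / 2) * ‖γ‖ ^ 2 + (inner ℝ γ (nbrSum ψ x) : ℝ))

/-- `μ` is an infinite-volume Gibbs measure on `(Iᶜ)^{ℤ^d}` for the interaction `𝒰^I`,
expressed through the single-site DLR equations. -/
def IsGibbs (d N : ℕ) (m2 : ℝ) (I : Set (Spin N)) (μ : Measure (ConfD d N)) : Prop :=
  IsProbabilityMeasure μ ∧ μ {ψ | ∃ x, ψ x ∈ I} = 0 ∧
    ∀ x : SiteD d, ∀ F : ConfD d N → ℝ, Measurable F → (∃ C, ∀ ψ, |F ψ| ≤ C) →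
      ∫ ψ, F ψ ∂μ =
        ∫ ψ,
          (∫ γ, ssWeight d N m2 I ψ x γ * F (Function.update ψ x γ)
              ∂(volume : Measure (Spin N))) /
            (∫ γ, ssWeight d N m2 I ψ x γ ∂(volume : Measure (Spin N))) ∂μ

/-- `𝒢₁(𝒰^I)`: the Gibbs measures with uniform first moments at each site. -/
def GibbsOne (d N : ℕ) (m2 : ℝ) (I : Set (Spin N)) : Set (Measure (ConfD d N)) :=
  {μ | IsGibbs d N m2 I μ ∧ ∃ C : ℝ, ∀ x, ∫⁻ ψ, ‖ψ x‖₊ ∂μ ≤ ENNReal.ofReal C}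

/-- `Λ_n = [-n/2, n/2]^d ∩ ℤ^d`. -/
def LamD (d n : ℕ) : Set (SiteD d) := {x | ∀ i, 2 * |x i| ≤ (n : ℤ)}

/-- the event `Ω^I_V = {ψ(x) ∉ I ∀ x ∈ V}`. -/
def avoidsD {d N : ℕ} (V : Set (SiteD d)) (I : Set (Spin N)) : Set (ConfD d N) :=
  {ψ | ∀ x ∈ V, ψ x ∉ I}

/-- `g` is the massive Green's function `(-Δ + m²)^{-1}` on `ℤ^d`: the bounded symmetric
fundamental solution. -/
def IsGreen (d : ℕ) (m2 : ℝ) (g : SiteD d → SiteD d → ℝ) : Prop :=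
  (∀ x y, g x y = g y x) ∧ (∃ C, ∀ x y, |g x y| ≤ C) ∧
    ∀ x y,
      (2 * d + m2) * g x y -
          ∑ e : Fin d, (g (x + unitv d e) y + g (x - unitv d e) y) =
        if x = y then 1 else 0

/-- `μ` is the law of the `N`-vectorial `m²`-massive GFF on `ℤ^d`: `N` i.i.d. centered
Gaussian coordinate fields with covariance the massive Green's function `g`. -/
def IsMassiveGFF (d N : ℕ) (g : SiteD d → SiteD d → ℝ) (μ : Measure (ConfD d N)) : Prop :=
  IsProbabilityMeasure μ ∧
    ∀ c : (SiteD d × Fin N) →₀ ℝ,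
      Measure.map (fun ψ => ∑ p ∈ c.support, c p * ψ p.1 p.2) μ =
        ProbabilityTheory.gaussianReal 0
          (Real.toNNReal (∑ p ∈ c.support, ∑ q ∈ c.support,
            c p * c q * (if p.2 = q.2 then g p.1 q.1 else 0)))

theorem IsGreen.nonneg {d : ℕ} {m2 : ℝ} {g : SiteD d → SiteD d → ℝ} (hm2 : 0 < m2)
    (hg : IsGreen d m2 g) (x y : SiteD d) : 0 ≤ g x y := by
  obtain ⟨-, ⟨C, hC⟩, hfund⟩ := hg
  have hbdd : BddBelow (Set.range fun z => g z y) :=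
    ⟨-C, by rintro _ ⟨z, rfl⟩; exact (abs_le.1 (hC z y)).1⟩
  set m := ⨅ z, g z y with hm
  have hle (z : SiteD d) : m ≤ g z y := ciInf_le hbdd z
  have hstep (z : SiteD d) : 2 * d * m ≤ (2 * d + m2) * g z y := by
    have h1 := hfund z y
    have h2 : ∑ _e : Fin d, (m + m) ≤ ∑ e : Fin d, (g (z + unitv d e) y + g (z - unitv d e) y) :=
      Finset.sum_le_sum fun e _ => add_le_add (hle _) (hle _)
    have h3 : (0 : ℝ) ≤ if z = y then 1 else 0 := by split_ifs <;> norm_num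
    simp only [Finset.sum_const, Finset.card_univ, Fintype.card_fin, nsmul_eq_mul] at h2
    nlinarith
  have hs : (0 : ℝ) < 2 * d + m2 := by positivity
  have h4 : 2 * d * m / (2 * d + m2) ≤ m :=
    le_ciInf fun z => by rw [div_le_iff₀ hs]; linarith [hstep z]
  rw [div_le_iff₀ hs] at h4
  have : 0 ≤ m := by
    by_contra! hneg
    nlinarith
  exact this.trans (hle x)

theorem IsGreen.diag_pos {d : ℕ} {m2 : ℝ} {g : SiteD d → SiteD d → ℝ} (hm2 : 0 < m2)
    (hg : IsGreen d m2 g) (x : SiteD d) : 0 < g x x := by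
  have h1 := hg.2.2 x x
  have h2 : 0 ≤ ∑ e : Fin d, (g (x + unitv d e) x + g (x - unitv d e) x) :=
    Finset.sum_nonneg fun e _ => add_nonneg (hg.nonneg hm2 _ _) (hg.nonneg hm2 _ _)
  have hs : (0 : ℝ) < 2 * d + m2 := by positivity
  simp only [if_true] at h1
  by_contra! hneg
  nlinarith

/-- The linear functional `c ↦ ∑ c p * ψ p.1 p.2` of finitely supported coefficients. -/
def pairing {d N : ℕ} (ψ : ConfD d N) : ((SiteD d × Fin N) →₀ ℝ) →ₗ[ℝ] ℝ :=
  Finsupp.linearCombination ℝ (fun p => ψ p.1 p.2)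

/-- The covariance form of the `N`-vectorial field with scalar covariance `g`. -/
def covForm {d : ℕ} (N : ℕ) (g : SiteD d → SiteD d → ℝ) :
    ((SiteD d × Fin N) →₀ ℝ) →ₗ[ℝ] ((SiteD d × Fin N) →₀ ℝ) →ₗ[ℝ] ℝ :=
  Finsupp.linearCombination ℝ
    (fun p => Finsupp.linearCombination ℝ (fun q => if p.2 = q.2 then g p.1 q.1 else 0))

theorem pairing_single {d N : ℕ} (ψ : ConfD d N) (p : SiteD d × Fin N) (r : ℝ) :
    pairing ψ (Finsupp.single p r) = r * ψ p.1 p.2 := by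
  simp [pairing]

theorem covForm_single_single {d N : ℕ} (g : SiteD d → SiteD d → ℝ) (p q : SiteD d × Fin N)
    (r t : ℝ) :
    covForm N g (Finsupp.single p r) (Finsupp.single q t) =
      r * t * (if p.2 = q.2 then g p.1 q.1 else 0) := by
  simp [covForm, mul_assoc, -mul_ite]

theorem covForm_comm {d N : ℕ} {g : SiteD d → SiteD d → ℝ} (hg : ∀ x y, g x y = g y x)
    (a b : (SiteD d × Fin N) →₀ ℝ) : covForm N g a b = covForm N g b a := by
  induction a using Finsupp.induction_linear with
  | zero => simp
  | add a a' h h' => simp [h, h']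
  | single p r =>
    induction b using Finsupp.induction_linear with
    | zero => simp
    | add b b' h h' => simp [h, h']
    | single q t =>
      rw [covForm_single_single, covForm_single_single, hg p.1 q.1, mul_comm r t]
      simp only [eq_comm]

theorem measurable_pairing {d N : ℕ} (c : (SiteD d × Fin N) →₀ ℝ) :
    Measurable fun ψ : ConfD d N => pairing ψ c := by
  simp only [pairing, Finsupp.linearCombination_apply, Finsupp.sum, smul_eq_mul]
  fun_prop

theorem IsMassiveGFF.map_pairing {d N : ℕ} {g : SiteD d → SiteD d → ℝ}
    {μ : Measure (ConfD d N)} (hμ : IsMassiveGFF d N g μ) (c : (SiteD d × Fin N) →₀ ℝ) :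
    μ.map (fun ψ => pairing ψ c) =
      ProbabilityTheory.gaussianReal 0 (Real.toNNReal (covForm N g c c)) := by
  have h1 := hμ.2 c
  have h2 : (fun ψ : ConfD d N => pairing ψ c) = fun ψ => ∑ p ∈ c.support, c p * ψ p.1 p.2 := by
    funext ψ
    simp [pairing, Finsupp.linearCombination_apply, Finsupp.sum]
  have h3 : covForm N g c c = ∑ p ∈ c.support, ∑ q ∈ c.support,
      c p * c q * (if p.2 = q.2 then g p.1 q.1 else 0) := by
    simp [covForm, Finsupp.linearCombination_apply, Finsupp.sum, Finset.mul_sum, mul_assoc]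
  rw [h2, h1, h3]

theorem IsMassiveGFF.covForm_nonneg {d N : ℕ} (hN : 0 < N) {m2 : ℝ} (hm2 : 0 < m2)
    {g : SiteD d → SiteD d → ℝ} (hg : IsGreen d m2 g)
    {μ : Measure (ConfD d N)} (hμ : IsMassiveGFF d N g μ) (c : (SiteD d × Fin N) →₀ ℝ) :
    0 ≤ covForm N g c c := by
  by_contra! hneg
  have hc : μ.map (fun ψ => pairing ψ c) = Measure.dirac 0 := by
    rw [hμ.map_pairing, Real.toNNReal_of_nonpos hneg.le, ProbabilityTheory.gaussianReal_zero_var]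
  have hae : ∀ᵐ ψ ∂μ, pairing ψ c = 0 := by
    have : ∀ᵐ z ∂(μ.map (fun ψ => pairing ψ c)), z = 0 := by
      rw [hc, ae_dirac_eq]; simp
    exact ae_of_ae_map (measurable_pairing c).aemeasurable this
  set δ : (SiteD d × Fin N) →₀ ℝ := Finsupp.single (0, ⟨0, hN⟩) 1 with hδ
  have hδδ : covForm N g δ δ = g 0 0 := by simp [hδ, covForm_single_single]
  have hpos : 0 < g 0 0 := hg.diag_pos hm2 0
  set b := covForm N g δ c
  set q := -covForm N g c c with hq
  have hq0 : 0 < q := by linarith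
  set t := (2 * |b| + g 0 0) / q + 1 with ht
  have htq : t * q = 2 * |b| + g 0 0 + q := by rw [ht]; field_simp
  have ht1 : 1 ≤ t := by
    rw [ht]; have : 0 ≤ (2 * |b| + g 0 0) / q := by positivity
    linarith
  have hBt : covForm N g (δ + t • c) (δ + t • c) ≤ 0 := by
    have hexp : covForm N g (δ + t • c) (δ + t • c) = g 0 0 + 2 * t * b - t * (t * q) := by
      simp only [map_add, map_smul, LinearMap.add_apply, LinearMap.smul_apply, smul_eq_mul,
        covForm_comm hg.1 c δ, hδδ]
      rw [hq]; ring
    rw [hexp, htq]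
    nlinarith [le_abs_self b, mul_nonneg (by linarith : (0 : ℝ) ≤ t) hq0.le,
      mul_le_mul_of_nonneg_left (le_abs_self b) (by linarith : (0 : ℝ) ≤ t)]
  have hsame : μ.map (fun ψ => pairing ψ (δ + t • c)) = μ.map (fun ψ => pairing ψ δ) := by
    refine Measure.map_congr ?_
    filter_upwards [hae] with ψ hψ
    simp [hψ]
  rw [hμ.map_pairing, hμ.map_pairing, Real.toNNReal_of_nonpos hBt, hδδ,
    ProbabilityTheory.gaussianReal_ext_iff] at hsame
  have := hsame.2
  rw [eq_comm, Real.toNNReal_eq_zero] at this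
  linarith

theorem IsMassiveGFF.integral_cexp_pairing {d N : ℕ} (hN : 0 < N) {m2 : ℝ} (hm2 : 0 < m2)
    {g : SiteD d → SiteD d → ℝ} (hg : IsGreen d m2 g)
    {μ : Measure (ConfD d N)} (hμ : IsMassiveGFF d N g μ) (c : (SiteD d × Fin N) →₀ ℝ) :
    ∫ ψ, Complex.exp (pairing ψ c * Complex.I) ∂μ =
      Complex.exp (-(covForm N g c c : ℝ) / 2) := by
  have h := ProbabilityTheory.charFun_gaussianReal (μ := 0)
    (v := Real.toNNReal (covForm N g c c)) 1
  rw [← hμ.map_pairing, charFun_apply_real,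
    integral_map (measurable_pairing c).aemeasurable (by fun_prop)] at h
  simp only [Complex.ofReal_one, one_mul, Real.coe_toNNReal _ (hμ.covForm_nonneg hN hm2 hg c)] at h
  rw [h]
  congr 1
  simp
  ring

/-- The centered Gaussian law on `ℝ^N` with covariance `s⁻¹ • id`. -/
def gaussNoise (N : ℕ) (s : ℝ) : Measure (Spin N) :=
  (volume : Measure (Spin N)).tilted (fun v => -(s / 2) * ‖v‖ ^ 2)

theorem integrable_exp_neg_mul_sq_norm (N : ℕ) {b : ℝ} (hb : 0 < b) :
    Integrable (fun v : Spin N => Real.exp (-b * ‖v‖ ^ 2)) := by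
  have h := (GaussianFourier.integrable_cexp_neg_mul_sq_norm_add (V := Spin N)
    (b := (b : ℂ)) (by simpa using hb) 0 0).norm
  refine h.congr (ae_of_all _ fun v => ?_)
  simp only [Complex.norm_exp]
  congr 1
  simp [← Complex.ofReal_pow]

theorem isProbabilityMeasure_gaussNoise (N : ℕ) {s : ℝ} (hs : 0 < s) :
    IsProbabilityMeasure (gaussNoise N s) :=
  isProbabilityMeasure_tilted (integrable_exp_neg_mul_sq_norm N (half_pos hs))

theorem integral_cexp_inner_gaussNoise (N : ℕ) {s : ℝ} (hs : 0 < s) (w : Spin N) :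
    ∫ v, Complex.exp ((inner ℝ w v : ℝ) * Complex.I) ∂(gaussNoise N s) =
      Complex.exp (-(‖w‖ ^ 2 / s : ℝ) / 2) := by
  have hb : 0 < ((s / 2 : ℝ) : ℂ).re := by simpa using half_pos hs
  have h1 := GaussianFourier.integral_cexp_neg_mul_sq_norm_add hb Complex.I w
  have h2 := GaussianFourier.integral_cexp_neg_mul_sq_norm (V := Spin N) hb
  have hZ : ((∫ v : Spin N, Real.exp (-(s / 2) * ‖v‖ ^ 2) : ℝ) : ℂ) =
      (π / ((s / 2 : ℝ) : ℂ)) ^ (Module.finrank ℝ (Spin N) / 2 : ℂ) := by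
    rw [← h2, ← integral_complex_ofReal]
    simp
  have hZ0 : (∫ v : Spin N, Real.exp (-(s / 2) * ‖v‖ ^ 2)) ≠ 0 :=
    (integral_exp_pos (integrable_exp_neg_mul_sq_norm N (half_pos hs))).ne'
  rw [gaussNoise, integral_tilted]
  have h3 : ∀ v : Spin N, (Real.exp (-(s / 2) * ‖v‖ ^ 2) /
      ∫ v : Spin N, Real.exp (-(s / 2) * ‖v‖ ^ 2)) •
        Complex.exp ((inner ℝ w v : ℝ) * Complex.I) =
      ((∫ v : Spin N, Real.exp (-(s / 2) * ‖v‖ ^ 2) : ℝ) : ℂ)⁻¹ *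
        Complex.exp (-((s / 2 : ℝ) : ℂ) * ‖v‖ ^ 2 + Complex.I * (inner ℝ w v : ℝ)) := by
    intro v
    rw [Complex.exp_add, Complex.real_smul]
    push_cast
    rw [mul_comm Complex.I]
    ring
  simp_rw [h3]
  rw [integral_const_mul, h1, ← hZ, ← mul_assoc, inv_mul_cancel₀ (by exact_mod_cast hZ0), one_mul]
  congr 1
  push_cast
  rw [Complex.I_sq]
  field_simp
  norm_num

/-- The conditional mean of the spin at `x` given its neighbours. -/
def nbrMean {d N : ℕ} (m2 : ℝ) (ψ : ConfD d N) (x : SiteD d) : Spin N :=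
  (2 * d + m2 : ℝ)⁻¹ • nbrSum ψ x

/-- Coefficients of the `i`-th coordinate of `ψ x - nbrMean m2 ψ x`. -/
def innovation {d N : ℕ} (m2 : ℝ) (x : SiteD d) (i : Fin N) : (SiteD d × Fin N) →₀ ℝ :=
  Finsupp.single (x, i) 1 - (2 * d + m2 : ℝ)⁻¹ •
    ∑ e : Fin d, (Finsupp.single (x + unitv d e, i) 1 + Finsupp.single (x - unitv d e, i) 1)

/-- The part of `c` orthogonal to the innovations at `x`. -/
def offSite {d N : ℕ} (m2 : ℝ) (x : SiteD d) (c : (SiteD d × Fin N) →₀ ℝ) :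
    (SiteD d × Fin N) →₀ ℝ :=
  c - ∑ i, c (x, i) • innovation m2 x i

theorem unitv_ne_zero {d : ℕ} (e : Fin d) : unitv d e ≠ 0 := fun h => by
  simpa [unitv] using congrFun h e

theorem pairing_innovation {d N : ℕ} (m2 : ℝ) (ψ : ConfD d N) (x : SiteD d) (i : Fin N) :
    pairing ψ (innovation m2 x i) = ψ x i - nbrMean m2 ψ x i := by
  simp [innovation, pairing_single, nbrMean, nbrSum]

theorem innovation_apply_self {d N : ℕ} (m2 : ℝ) (x : SiteD d) (i j : Fin N) :
    innovation m2 x i (x, j) = if i = j then 1 else 0 := by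
  have h1 (e : Fin d) : x + unitv d e ≠ x := by simpa using unitv_ne_zero e
  have h2 (e : Fin d) : x - unitv d e ≠ x := by simpa using unitv_ne_zero e
  simp [innovation, Finsupp.single_apply, h1, h2]

theorem covForm_innovation {d N : ℕ} {m2 : ℝ} (hm2 : 0 < m2) {g : SiteD d → SiteD d → ℝ}
    (hg : IsGreen d m2 g) (x : SiteD d) (i : Fin N) (c : (SiteD d × Fin N) →₀ ℝ) :
    covForm N g (innovation m2 x i) c = c (x, i) / (2 * d + m2) := by
  induction c using Finsupp.induction_linear with
  | zero => simp
  | add b b' h h' => simp [h, h', add_div]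
  | single q t =>
    obtain ⟨y, j⟩ := q
    have hs : (2 * d + m2 : ℝ) ≠ 0 := by positivity
    have h := hg.2.2 x y
    have hcalc : covForm N g (innovation m2 x i) (Finsupp.single (y, j) t) =
        t * (if i = j then g x y - (2 * d + m2 : ℝ)⁻¹ *
          ∑ e : Fin d, (g (x + unitv d e) y + g (x - unitv d e) y) else 0) := by
      simp only [innovation, map_sub, map_smul, map_sum, map_add, LinearMap.sub_apply,
        LinearMap.smul_apply, LinearMap.sum_apply, LinearMap.add_apply, covForm_single_single]
      split_ifs
      · simp [← mul_add, ← Finset.mul_sum]; ring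
      · simp
    rw [hcalc, Finsupp.single_apply]
    have h' : g x y - (2 * d + m2 : ℝ)⁻¹ *
        ∑ e : Fin d, (g (x + unitv d e) y + g (x - unitv d e) y) =
          (2 * d + m2 : ℝ)⁻¹ * (if x = y then 1 else 0) := by
      rw [← h]; field_simp
    rw [h']
    by_cases hij : i = j <;> by_cases hxy : x = y <;>
      simp [hij, hxy, eq_comm, div_eq_mul_inv]

theorem covForm_offSite {d N : ℕ} {m2 : ℝ} (hm2 : 0 < m2) {g : SiteD d → SiteD d → ℝ}
    (hg : IsGreen d m2 g) (x : SiteD d) (c : (SiteD d × Fin N) →₀ ℝ) :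
    covForm N g (offSite m2 x c) (offSite m2 x c) =
      covForm N g c c - (∑ i, c (x, i) ^ 2) / (2 * d + m2) := by
  have h1 (b : (SiteD d × Fin N) →₀ ℝ) :
      covForm N g (∑ i, c (x, i) • innovation m2 x i) b =
        ∑ i, c (x, i) * (b (x, i) / (2 * d + m2)) := by
    simp [LinearMap.sum_apply, covForm_innovation hm2 hg]
  have h2 (i : Fin N) : (∑ j, c (x, j) • innovation m2 x j) (x, i) = c (x, i) := by
    simp [Finsupp.finsetSum_apply, innovation_apply_self]
  rw [offSite, map_sub, map_sub, LinearMap.sub_apply, LinearMap.sub_apply, h1,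
    covForm_comm hg.1 c (∑ i, c (x, i) • innovation m2 x i), h1, h1]
  simp only [h2]
  rw [Finset.sum_div]
  simp only [sub_self, sub_zero]
  congr 1
  exact Finset.sum_congr rfl fun i _ => by ring

theorem pairing_update {d N : ℕ} (m2 : ℝ) (ψ : ConfD d N) (x : SiteD d) (v : Spin N)
    (c : (SiteD d × Fin N) →₀ ℝ) :
    pairing (Function.update ψ x (nbrMean m2 ψ x + v)) c =
      pairing ψ (offSite m2 x c) + ∑ i, c (x, i) * v i := by
  induction c using Finsupp.induction_linear with
  | zero => simp [offSite]
  | add b b' h h' =>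
    have : offSite m2 x (b + b') = offSite m2 x b + offSite m2 x b' := by
      simp only [offSite, Finsupp.add_apply, add_smul, Finset.sum_add_distrib]
      abel
    rw [map_add, h, h', this, map_add]
    simp only [Finsupp.add_apply, add_mul, Finset.sum_add_distrib]
    ring
  | single q t =>
    obtain ⟨y, j⟩ := q
    rw [pairing_single, offSite, map_sub, map_sum, pairing_single]
    simp only [map_smul, pairing_innovation, Finsupp.single_apply, smul_eq_mul]
    by_cases hxy : y = x
    · subst hxy
      simp
      ring
    · simp [hxy]

theorem nbrSum_update {d N : ℕ} (ψ : ConfD d N) (x : SiteD d) (v : Spin N) :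
    nbrSum (Function.update ψ x v) x = nbrSum ψ x := by
  have h1 (e : Fin d) : x + unitv d e ≠ x := by simpa using unitv_ne_zero e
  have h2 (e : Fin d) : x - unitv d e ≠ x := by simpa using unitv_ne_zero e
  simp [nbrSum, Function.update_of_ne, h1, h2]

theorem nbrMean_update {d N : ℕ} (m2 : ℝ) (ψ : ConfD d N) (x : SiteD d) (v : Spin N) :
    nbrMean m2 (Function.update ψ x v) x = nbrMean m2 ψ x := by
  rw [nbrMean, nbrSum_update, nbrMean]

theorem continuous_nbrSum {d N : ℕ} (x : SiteD d) :
    Continuous fun ψ : ConfD d N => nbrSum ψ x := by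
  unfold nbrSum
  fun_prop

theorem continuous_nbrMean {d N : ℕ} (m2 : ℝ) (x : SiteD d) :
    Continuous fun ψ : ConfD d N => nbrMean m2 ψ x := by
  unfold nbrMean
  exact Continuous.const_smul (continuous_nbrSum x) (2 * d + m2 : ℝ)⁻¹

/-- Replacing the spin at `x` by the conditional mean plus a noise. -/
def resample {d N : ℕ} (m2 : ℝ) (x : SiteD d) (p : ConfD d N × Spin N) : ConfD d N :=
  Function.update p.1 x (nbrMean m2 p.1 x + p.2)

theorem measurable_resample {d N : ℕ} (m2 : ℝ) (x : SiteD d) :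
    Measurable (resample (N := N) m2 x) := by
  have : Continuous (resample (N := N) m2 x) :=
    continuous_fst.update x (((continuous_nbrMean m2 x).comp continuous_fst).add continuous_snd)
  exact this.measurable

theorem ext_of_integral_cexp_pairing {d N : ℕ} {μ ν : Measure (ConfD d N)}
    [IsFiniteMeasure μ] [IsFiniteMeasure ν]
    (h : ∀ c : (SiteD d × Fin N) →₀ ℝ, ∫ ψ, Complex.exp (pairing ψ c * Complex.I) ∂μ =
      ∫ ψ, Complex.exp (pairing ψ c * Complex.I) ∂ν) : μ = ν := by
  have key (I : Finset (SiteD d)) : μ.map I.restrict = ν.map I.restrict := by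
    refine Measure.ext_of_charFunDual (funext fun L => ?_)
    rw [charFunDual_apply, charFunDual_apply,
      integral_map (by fun_prop) (by fun_prop), integral_map (by fun_prop) (by fun_prop)]
    let b := EuclideanSpace.basisFun (Fin N) ℝ
    let c : (SiteD d × Fin N) →₀ ℝ := ∑ y : I, ∑ j : Fin N,
      Finsupp.single ((y : SiteD d), j) (L (Pi.single y (b j)))
    have hL (ψ : ConfD d N) : L (I.restrict ψ) = pairing ψ c := by
      have h1 : I.restrict ψ = ∑ y : I, ∑ j : Fin N, (ψ y j) • (Pi.single y (b j) : I → Spin N) := by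
        funext z
        rw [Finset.sum_apply, Finset.sum_eq_single z]
        · simp only [Finset.sum_apply, Pi.smul_apply, Pi.single_eq_same]
          exact (b.sum_repr (ψ z)).symm
        · intro y _ hyz
          simp [Pi.single_eq_of_ne hyz.symm]
        · simp
      rw [h1]
      simp only [c, map_sum, map_smul, pairing_single, smul_eq_mul]
      exact Finset.sum_congr rfl fun y _ => Finset.sum_congr rfl fun j _ => mul_comm _ _
    simp only [hL]
    exact h c
  exact IsProjectiveLimit.unique (P := fun I => ν.map I.restrict) key fun I => rfl

theorem IsMassiveGFF.map_resample {d N : ℕ} (hN : 0 < N) {m2 : ℝ} (hm2 : 0 < m2)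
    {g : SiteD d → SiteD d → ℝ} (hg : IsGreen d m2 g)
    {μ : Measure (ConfD d N)} (hμ : IsMassiveGFF d N g μ) (x : SiteD d) :
    (μ.prod (gaussNoise N (2 * d + m2))).map (resample m2 x) = μ := by
  have hs : (0 : ℝ) < 2 * d + m2 := by positivity
  have := hμ.1
  have := isProbabilityMeasure_gaussNoise N hs
  have : IsProbabilityMeasure ((μ.prod (gaussNoise N (2 * d + m2))).map (resample m2 x)) :=
    Measure.isProbabilityMeasure_map (measurable_resample m2 x).aemeasurable
  refine ext_of_integral_cexp_pairing fun c => ?_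
  have hmeas : Measurable fun ψ : ConfD d N => Complex.exp (pairing ψ c * Complex.I) := by
    have := measurable_pairing (d := d) (N := N) c
    fun_prop
  rw [integral_map (measurable_resample m2 x).aemeasurable hmeas.aestronglyMeasurable,
    hμ.integral_cexp_pairing hN hm2 hg]
  let w : Spin N := WithLp.toLp 2 fun i => c (x, i)
  have hsplit (p : ConfD d N × Spin N) :
      Complex.exp (pairing (resample m2 x p) c * Complex.I) =
        Complex.exp (pairing p.1 (offSite m2 x c) * Complex.I) *
          Complex.exp ((inner ℝ w p.2 : ℝ) * Complex.I) := by
    rw [resample, pairing_update, ← Complex.exp_add]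
    congr 1
    have : (inner ℝ w p.2 : ℝ) = ∑ i, c (x, i) * p.2 i := by
      simp [w, PiLp.inner_apply, mul_comm]
    rw [this]
    push_cast
    ring
  have hw : ‖w‖ ^ 2 = ∑ i, c (x, i) ^ 2 := by
    simp [w, EuclideanSpace.norm_sq_eq]
  simp only [hsplit]
  rw [integral_prod_mul (fun ψ => Complex.exp (pairing ψ (offSite m2 x c) * Complex.I))
      (fun v => Complex.exp ((inner ℝ w v : ℝ) * Complex.I)),
    hμ.integral_cexp_pairing hN hm2 hg, integral_cexp_inner_gaussNoise N hs,
    covForm_offSite hm2 hg, hw, ← Complex.exp_add]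
  congr 1
  push_cast
  ring

theorem exp_neg_sq_add_le {s : ℝ} (hs : 0 < s) (M t : ℝ) :
    Real.exp (-(s / 2) * t ^ 2 + M * t) ≤
      Real.exp (M ^ 2 / s) * Real.exp (-(s / 4) * t ^ 2) := by
  rw [← Real.exp_add, Real.exp_le_exp]
  have h : M ^ 2 / s + s / 4 * t ^ 2 - M * t = (M - s * t / 2) ^ 2 / s := by
    field_simp
    ring
  have : 0 ≤ (M - s * t / 2) ^ 2 / s := by positivity
  linarith

theorem lintegral_enorm_gaussNoise_ne_top (N : ℕ) {s : ℝ} (hs : 0 < s) :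
    ∫⁻ v, ‖v‖ₑ ∂(gaussNoise N s) ≠ ⊤ := by
  have hint : Integrable (fun v : Spin N => v) (gaussNoise N s) := by
    rw [gaussNoise, integrable_tilted_iff]
    refine ((integrable_exp_neg_mul_sq_norm N (by positivity : 0 < s / 4)).const_mul
      (Real.exp (1 ^ 2 / s))).mono' (by fun_prop) (ae_of_all _ fun v => ?_)
    refine le_trans ?_ (exp_neg_sq_add_le hs 1 ‖v‖)
    rw [norm_smul, Real.norm_of_nonneg (Real.exp_pos _).le, Real.exp_add]
    gcongr
    linarith [Real.add_one_le_exp (1 * ‖v‖)]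
    exact integrable_exp_neg_mul_sq_norm N (half_pos hs)
  exact hint.2.ne

theorem map_neg_gaussNoise (N : ℕ) (s : ℝ) :
    (gaussNoise N s).map (fun v => -v) = gaussNoise N s := by
  ext A hA
  rw [Measure.map_apply measurable_neg hA, gaussNoise, tilted_apply _ _, tilted_apply _ _,
    ← lintegral_indicator hA, ← lintegral_indicator (measurable_neg hA),
    ← lintegral_neg_eq_self]
  congr 1 with v
  simp [Set.indicator]

theorem measurableSet_add_notMem_ball {N : ℕ} (h : Spin N) (R : ℝ) :
    MeasurableSet {v | h + v ∉ Metric.ball (0 : Spin N) R} := by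
  have hmeas : Measurable fun v : Spin N => h + v := by fun_prop
  exact hmeas (measurableSet_ball (x := (0 : Spin N)) (ε := R)).compl

theorem exists_gaussNoise_lower_bound {N : ℕ} (hN : 0 < N) {s : ℝ} (hs : 0 < s) (R : ℝ) :
    ∃ p : ℝ≥0∞, 0 < p ∧
      ∀ h : Spin N, p ≤ gaussNoise N s {v | h + v ∉ Metric.ball (0 : Spin N) R} := by
  let ν := gaussNoise N s
  have hq : 0 < ν {v | R < ‖v‖} := by
    have hac : (volume : Measure (Spin N)) ≪ ν :=
      absolutelyContinuous_tilted (integrable_exp_neg_mul_sq_norm N (half_pos hs))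
    have hopen : IsOpen {v : Spin N | R < ‖v‖} := isOpen_lt continuous_const continuous_norm
    have : Nonempty (Fin N) := ⟨⟨0, hN⟩⟩
    obtain ⟨v, hv⟩ := NormedSpace.exists_lt_norm ℝ (Spin N) R
    have hvol := hopen.measure_pos volume ⟨v, hv⟩
    exact pos_iff_ne_zero.2 fun h => hvol.ne' (hac h)
  refine ⟨ν {v | R < ‖v‖} / 2, ENNReal.div_pos hq.ne' (by simp), fun h => ?_⟩
  have hsymm : ν {v | h - v ∉ Metric.ball (0 : Spin N) R} =
      ν {v | h + v ∉ Metric.ball (0 : Spin N) R} := by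
    have hmeas := measurableSet_add_notMem_ball h R
    have hmap := Measure.map_apply (μ := ν) measurable_neg hmeas
    rw [map_neg_gaussNoise N s] at hmap
    rw [hmap]
    rfl
  have hsub : {v : Spin N | R < ‖v‖} ⊆ {v | h + v ∉ Metric.ball (0 : Spin N) R} ∪
      {v | h - v ∉ Metric.ball (0 : Spin N) R} := by
    intro v hv
    by_contra hcon
    simp only [Set.mem_union, Set.mem_ofPred_eq, mem_ball_zero_iff, not_or, not_not] at hcon hv
    have hpar := parallelogram_law_with_norm ℝ h v
    nlinarith [norm_nonneg (h + v), norm_nonneg (h - v), norm_nonneg h, norm_nonneg v,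
      mul_self_nonneg ‖h‖]
  have h2 := (measure_mono (μ := ν) hsub).trans (measure_union_le _ _)
  rw [hsymm, ← two_mul] at h2
  exact ENNReal.div_le_of_le_mul' h2

theorem measurableSet_avoidsD {d N : ℕ} (V : Set (SiteD d)) {I : Set (Spin N)}
    (hI : MeasurableSet I) : MeasurableSet (avoidsD V I) := by
  have : avoidsD V I = ⋂ x ∈ V, (fun ψ : ConfD d N => ψ x) ⁻¹' Iᶜ := by
    ext ψ; simp [avoidsD]
  rw [this]
  exact MeasurableSet.biInter V.to_countable fun x _ => measurable_pi_apply x hI.compl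

theorem update_mem_avoidsD {d N : ℕ} (V : Set (SiteD d)) (I : Set (Spin N)) (ψ : ConfD d N)
    (x : SiteD d) (γ : Spin N) :
    Function.update ψ x γ ∈ avoidsD V I ↔ ψ ∈ avoidsD (V \ {x}) I ∧ (x ∈ V → γ ∉ I) := by
  constructor
  · intro h
    refine ⟨fun y hy => ?_, fun hx => by simpa using h x hx⟩
    simpa [Function.update_of_ne hy.2] using h y hy.1
  · rintro ⟨h1, h2⟩ y hy
    by_cases hyx : y = x
    · subst hyx; simpa using h2 hy
    · rw [Function.update_of_ne hyx]; exact h1 y ⟨hy, hyx⟩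

/-- The noises at `x` for which the resampled spin is admissible. -/
def admissible {d N : ℕ} (m2 : ℝ) (V : Set (SiteD d)) (I : Set (Spin N)) (x : SiteD d)
    (ψ : ConfD d N) : Set (Spin N) :=
  {v | x ∈ V → nbrMean m2 ψ x + v ∉ I}

theorem measurableSet_admissible {d N : ℕ} (m2 : ℝ) (V : Set (SiteD d)) {I : Set (Spin N)}
    (hI : MeasurableSet I) (x : SiteD d) (ψ : ConfD d N) :
    MeasurableSet (admissible m2 V I x ψ) := by
  by_cases hx : x ∈ V
  · have : admissible m2 V I x ψ = (fun v => nbrMean m2 ψ x + v) ⁻¹' Iᶜ := by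
      ext v; simp [admissible, hx]
    rw [this]
    exact measurable_const_add _ hI.compl
  · have : admissible m2 V I x ψ = Set.univ := by
      ext v; simp [admissible, hx]
    rw [this]
    exact MeasurableSet.univ

theorem le_gaussNoise_admissible {d N : ℕ} {m2 s : ℝ} (V : Set (SiteD d))
    {I : Set (Spin N)} {p : ℝ≥0∞} (hp : ∀ h : Spin N, p ≤ gaussNoise N s {v | h + v ∉ I})
    (x : SiteD d) (ψ : ConfD d N) : p ≤ gaussNoise N s (admissible m2 V I x ψ) := by
  refine (hp (nbrMean m2 ψ x)).trans (measure_mono ?_)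
  intro v hv _
  exact hv

theorem setLIntegral_resample {d N : ℕ} {m2 : ℝ} (hm2 : 0 < m2) {μ : Measure (ConfD d N)}
    [IsProbabilityMeasure μ] {x : SiteD d}
    (hres : (μ.prod (gaussNoise N (2 * d + m2))).map (resample m2 x) = μ)
    (V : Set (SiteD d)) {I : Set (Spin N)} (hI : MeasurableSet I)
    {F : ConfD d N → ℝ≥0∞} (hF : Measurable F) :
    ∫⁻ ψ in avoidsD V I, F ψ ∂μ =
      ∫⁻ ψ in avoidsD (V \ {x}) I, ∫⁻ v in admissible m2 V I x ψ,
        F (resample m2 x (ψ, v)) ∂(gaussNoise N (2 * d + m2)) ∂μ := by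
  have hs : (0 : ℝ) < 2 * d + m2 := by positivity
  have := isProbabilityMeasure_gaussNoise N hs
  rw [← lintegral_indicator (measurableSet_avoidsD V hI),
    ← lintegral_indicator (measurableSet_avoidsD _ hI)]
  conv_lhs => rw [← hres]
  have hG : Measurable ((avoidsD V I).indicator F) := hF.indicator (measurableSet_avoidsD V hI)
  have hGm : Measurable fun z => (avoidsD V I).indicator F (resample m2 x z) :=
    hG.comp (measurable_resample m2 x)
  rw [lintegral_map hG (measurable_resample m2 x), lintegral_prod _ hGm.aemeasurable]
  refine lintegral_congr fun ψ => ?_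
  have hiff (v : Spin N) : resample m2 x (ψ, v) ∈ avoidsD V I ↔
      ψ ∈ avoidsD (V \ {x}) I ∧ v ∈ admissible m2 V I x ψ := update_mem_avoidsD V I ψ x _
  by_cases hψ : ψ ∈ avoidsD (V \ {x}) I
  · rw [Set.indicator_of_mem hψ, ← lintegral_indicator (measurableSet_admissible m2 V hI x ψ)]
    refine lintegral_congr fun v => ?_
    simp only [Set.indicator, hiff, hψ, true_and]
  · rw [Set.indicator_of_notMem hψ]
    simp [Set.indicator, hiff, hψ]

theorem measure_avoidsD_pos {d N : ℕ} (hN : 0 < N) {m2 : ℝ} (hm2 : 0 < m2) (R : ℝ)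
    {μ : Measure (ConfD d N)} [IsProbabilityMeasure μ]
    (hres : ∀ x, (μ.prod (gaussNoise N (2 * d + m2))).map (resample m2 x) = μ)
    {V : Set (SiteD d)} (hV : V.Finite) :
    0 < μ (avoidsD V (Metric.ball (0 : Spin N) R)) := by
  have hs : (0 : ℝ) < 2 * d + m2 := by positivity
  obtain ⟨p, hp0, hp⟩ := exists_gaussNoise_lower_bound hN hs R
  induction V, hV using Set.Finite.induction_on with
  | empty => simp [avoidsD]
  | @insert x V hx _ ih =>
    have hI : MeasurableSet (Metric.ball (0 : Spin N) R) := measurableSet_ball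
    have h := setLIntegral_resample hm2 (hres x) (insert x V) hI measurable_one
    simp only [Pi.one_apply, lintegral_one, Measure.restrict_apply_univ] at h
    rw [Set.insert_sdiff_self_of_notMem hx] at h
    rw [h]
    calc 0 < p * μ (avoidsD V (Metric.ball (0 : Spin N) R)) := ENNReal.mul_pos hp0.ne' ih.ne'
      _ = ∫⁻ _ in avoidsD V (Metric.ball (0 : Spin N) R), p ∂μ := by simp
      _ ≤ _ := lintegral_mono fun ψ => le_gaussNoise_admissible _ hp x ψ

theorem exists_setLIntegral_enorm_le {d N : ℕ} (hN : 0 < N) {m2 : ℝ} (hm2 : 0 < m2) (R : ℝ) :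
    ∃ K : ℝ≥0∞, K ≠ ⊤ ∧ ∀ (μ : Measure (ConfD d N)) (_ : IsProbabilityMeasure μ) (x : SiteD d)
      (_ : (μ.prod (gaussNoise N (2 * d + m2))).map (resample m2 x) = μ) (V : Set (SiteD d)),
      ∫⁻ ψ in avoidsD V (Metric.ball (0 : Spin N) R), ‖ψ x‖ₑ ∂μ ≤
        ∫⁻ ψ in avoidsD V (Metric.ball (0 : Spin N) R), (‖nbrMean m2 ψ x‖ₑ + K) ∂μ := by
  have hs : (0 : ℝ) < 2 * d + m2 := by positivity
  obtain ⟨p, hp0, hp⟩ := exists_gaussNoise_lower_bound hN hs R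
  have hprob := isProbabilityMeasure_gaussNoise N hs
  have hptop : p ≠ ⊤ := ((hp 0).trans_lt (measure_lt_top _ _)).ne
  set ν := gaussNoise N (2 * d + m2) with hν
  set M := ∫⁻ v, ‖v‖ₑ ∂ν with hM
  refine ⟨M / p, ENNReal.div_ne_top (lintegral_enorm_gaussNoise_ne_top N hs) hp0.ne', ?_⟩
  intro μ hμ x hres V
  have hI : MeasurableSet (Metric.ball (0 : Spin N) R) := measurableSet_ball
  have hmean : Measurable fun ψ : ConfD d N => nbrMean m2 ψ x := (continuous_nbrMean m2 x).measurable
  rw [setLIntegral_resample hm2 hres V hI (by fun_prop),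
    setLIntegral_resample hm2 hres V hI (by fun_prop)]
  refine lintegral_mono fun ψ => ?_
  simp only [resample, Function.update_self, nbrMean_update]
  rw [lintegral_const, Measure.restrict_apply_univ]
  set a := ν (admissible m2 V (Metric.ball (0 : Spin N) R) x ψ)
  have ha : p ≤ a := le_gaussNoise_admissible V hp x ψ
  calc ∫⁻ v in admissible m2 V (Metric.ball (0 : Spin N) R) x ψ, ‖nbrMean m2 ψ x + v‖ₑ ∂ν
      ≤ ∫⁻ v in admissible m2 V (Metric.ball (0 : Spin N) R) x ψ, (‖nbrMean m2 ψ x‖ₑ + ‖v‖ₑ) ∂ν :=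
        lintegral_mono fun v => enorm_add_le _ _
    _ = ‖nbrMean m2 ψ x‖ₑ * a +
          ∫⁻ v in admissible m2 V (Metric.ball (0 : Spin N) R) x ψ, ‖v‖ₑ ∂ν := by
        rw [lintegral_add_left measurable_const, lintegral_const, Measure.restrict_apply_univ]
    _ ≤ ‖nbrMean m2 ψ x‖ₑ * a + M / p * a := by
        gcongr
        calc _ ≤ M := setLIntegral_le_lintegral _ _
          _ = M / p * p := (ENNReal.div_mul_cancel hp0.ne' hptop).symm
          _ ≤ M / p * a := by gcongr
    _ = (‖nbrMean m2 ψ x‖ₑ + M / p) * a := (add_mul _ _ _).symm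

theorem IsMassiveGFF.exists_lintegral_enorm_le {d N : ℕ} {m2 : ℝ}
    {g : SiteD d → SiteD d → ℝ} (hg : IsGreen d m2 g)
    {μ : Measure (ConfD d N)} (hμ : IsMassiveGFF d N g μ) :
    ∃ C : ℝ≥0∞, C ≠ ⊤ ∧ ∀ x, ∫⁻ ψ, ‖ψ x‖ₑ ∂μ ≤ C := by
  obtain ⟨B, hB⟩ := hg.2.1
  refine ⟨∑ _i : Fin N, (1 + ENNReal.ofReal B), by simp [ENNReal.mul_eq_top], fun x => ?_⟩
  have hcoord (i : Fin N) : ∫⁻ ψ, ‖ψ x i‖ₑ ∂μ ≤ 1 + ENNReal.ofReal B := by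
    set ρ := ProbabilityTheory.gaussianReal 0 (Real.toNNReal (g x x)) with hρ
    have hlaw : μ.map (fun ψ => ψ x i) = ρ := by
      have := hμ.map_pairing (Finsupp.single (x, i) 1)
      simpa [pairing_single, covForm_single_single] using this
    have h1 : ∫⁻ ψ, ‖ψ x i‖ₑ ∂μ = ∫⁻ t, ‖t‖ₑ ∂ρ := by
      rw [← hlaw, lintegral_map (by fun_prop) (by fun_prop)]
    have h2 : ∫⁻ t : ℝ, ‖t‖ₑ ^ 2 ∂ρ = ENNReal.ofReal (ProbabilityTheory.variance id ρ) := by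
      rw [(ProbabilityTheory.memLp_id_gaussianReal 2).ofReal_variance_eq,
        ProbabilityTheory.evariance]
      simp [hρ]
    rw [h1]
    calc ∫⁻ t, ‖t‖ₑ ∂ρ ≤ ∫⁻ t, (1 + ‖t‖ₑ ^ 2) ∂ρ := by
          refine lintegral_mono fun t => ?_
          rcases le_total ‖t‖ₑ 1 with h | h
          · exact h.trans le_self_add
          · calc ‖t‖ₑ ≤ ‖t‖ₑ ^ 2 := le_self_pow₀ h (by norm_num)
              _ ≤ _ := le_add_self
      _ = 1 + ENNReal.ofReal (ProbabilityTheory.variance id ρ) := by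
          rw [lintegral_add_left measurable_const, h2]
          simp
      _ ≤ 1 + ENNReal.ofReal B := by
          gcongr
          rw [hρ, ProbabilityTheory.variance_id_gaussianReal]
          rw [Real.coe_toNNReal']
          exact max_le ((le_abs_self _).trans (hB x x)) ((abs_nonneg _).trans (hB x x))
  calc ∫⁻ ψ, ‖ψ x‖ₑ ∂μ ≤ ∫⁻ ψ, ∑ i, ‖ψ x i‖ₑ ∂μ := by
        refine lintegral_mono fun ψ => ?_
        let b := EuclideanSpace.basisFun (Fin N) ℝ
        calc ‖ψ x‖ₑ = ‖∑ i, ψ x i • b i‖ₑ := by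
              congr 1; exact (b.sum_repr (ψ x)).symm
          _ ≤ ∑ i, ‖ψ x i • b i‖ₑ := enorm_sum_le _ _
          _ = ∑ i, ‖ψ x i‖ₑ := by
              refine Finset.sum_congr rfl fun i _ => ?_
              rw [enorm_smul]
              have : ‖b i‖ₑ = 1 := by rw [← ofReal_norm, b.norm_eq_one, ENNReal.ofReal_one]
              rw [this, mul_one]
    _ = ∑ i, ∫⁻ ψ, ‖ψ x i‖ₑ ∂μ := lintegral_finsetSum _ fun i _ => by fun_prop
    _ ≤ _ := Finset.sum_le_sum fun i _ => hcoord i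

theorem LamD_finite (d n : ℕ) : (LamD d n).Finite := by
  refine (Set.Finite.pi' fun _ : Fin d => Set.finite_Icc (-(n : ℤ)) n).subset fun x hx i => ?_
  have h := hx i
  have h1 := le_abs_self (x i)
  have h2 := neg_abs_le (x i)
  have h3 := abs_nonneg (x i)
  constructor <;> linarith

theorem exists_mem_LamD {d : ℕ} (x : SiteD d) : ∃ n₀ : ℕ, ∀ n, n₀ ≤ n → x ∈ LamD d n := by
  refine ⟨∑ i, (2 * |x i|).toNat, fun n hn i => ?_⟩
  have h : (2 * |x i|).toNat ≤ ∑ j, (2 * |x j|).toNat :=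
    Finset.single_le_sum (f := fun j => (2 * |x j|).toNat) (fun _ _ => Nat.zero_le _)
      (Finset.mem_univ i)
  have := Int.self_le_toNat (2 * |x i|)
  omega

theorem enorm_nbrMean_le {d N : ℕ} {m2 : ℝ} (hm2 : 0 < m2) (ψ : ConfD d N) (x : SiteD d) :
    ‖nbrMean m2 ψ x‖ₑ ≤ ENNReal.ofReal (2 * d + m2)⁻¹ *
      ∑ e : Fin d, (‖ψ (x + unitv d e)‖ₑ + ‖ψ (x - unitv d e)‖ₑ) := by
  have hs : (0 : ℝ) < 2 * d + m2 := by positivity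
  rw [nbrMean, enorm_smul, Real.enorm_of_nonneg (by positivity)]
  gcongr
  refine (enorm_sum_le _ _).trans (Finset.sum_le_sum fun e _ => enorm_add_le _ _)

theorem exists_cond_lintegral_enorm_le {d N : ℕ} (hN : 0 < N) {m2 : ℝ} (hm2 : 0 < m2) (R : ℝ)
    {μ : Measure (ConfD d N)} [IsProbabilityMeasure μ]
    (hres : ∀ x, (μ.prod (gaussNoise N (2 * d + m2))).map (resample m2 x) = μ)
    (hmom : ∃ C : ℝ≥0∞, C ≠ ⊤ ∧ ∀ x, ∫⁻ ψ, ‖ψ x‖ₑ ∂μ ≤ C) :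
    ∃ C : ℝ, 0 < C ∧ ∀ V : Set (SiteD d), V.Finite → ∀ x,
      ∫⁻ ψ, ‖ψ x‖ₑ ∂(ProbabilityTheory.cond μ (avoidsD V (Metric.ball (0 : Spin N) R))) ≤
        ENNReal.ofReal C := by
  have hs : (0 : ℝ) < 2 * d + m2 := by positivity
  obtain ⟨K, hK, hKle⟩ := exists_setLIntegral_enorm_le (d := d) hN hm2 R
  obtain ⟨C₀, hC₀, hC₀le⟩ := hmom
  refine ⟨K.toReal * (2 * d + m2) / m2 + 1, by positivity, fun V hV x => ?_⟩
  set Ω := avoidsD V (Metric.ball (0 : Spin N) R) with hΩ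
  have hpos : μ Ω ≠ 0 := (measure_avoidsD_pos hN hm2 R hres hV).ne'
  have hprob : IsProbabilityMeasure (ProbabilityTheory.cond μ Ω) :=
    ProbabilityTheory.cond_isProbabilityMeasure hpos
  set ρ := ProbabilityTheory.cond μ Ω with hρ
  have hint (f : ConfD d N → ℝ≥0∞) : ∫⁻ ψ, f ψ ∂ρ = (μ Ω)⁻¹ * ∫⁻ ψ in Ω, f ψ ∂μ := by
    rw [hρ, ProbabilityTheory.cond, lintegral_smul_measure, smul_eq_mul]
  set U := ⨆ y, ∫⁻ ψ, ‖ψ y‖ₑ ∂ρ with hU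
  have hle (y : SiteD d) : ∫⁻ ψ, ‖ψ y‖ₑ ∂ρ ≤ U := le_iSup (fun y => ∫⁻ ψ, ‖ψ y‖ₑ ∂ρ) y
  have hUtop : U ≠ ⊤ := by
    have : U ≤ (μ Ω)⁻¹ * C₀ := by
      refine iSup_le fun y => ?_
      rw [hint]
      gcongr
      exact (setLIntegral_le_lintegral _ _).trans (hC₀le y)
    exact (this.trans_lt (ENNReal.mul_lt_top (ENNReal.inv_lt_top.2 (pos_iff_ne_zero.2 hpos))
      hC₀.lt_top)).ne
  have hrec : U ≤ ENNReal.ofReal (2 * d + m2)⁻¹ * (2 * d * U) + K := by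
    refine iSup_le fun y => ?_
    calc ∫⁻ ψ, ‖ψ y‖ₑ ∂ρ ≤ ∫⁻ ψ, (‖nbrMean m2 ψ y‖ₑ + K) ∂ρ := by
          rw [hint, hint]
          gcongr 1
          exact hKle μ inferInstance y (hres y) V
      _ = ∫⁻ ψ, ‖nbrMean m2 ψ y‖ₑ ∂ρ + K := by
          rw [lintegral_add_right _ measurable_const]; simp
      _ ≤ ENNReal.ofReal (2 * d + m2)⁻¹ * (2 * d * U) + K := by
          gcongr
          calc ∫⁻ ψ, ‖nbrMean m2 ψ y‖ₑ ∂ρ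
              ≤ ∫⁻ ψ, ENNReal.ofReal (2 * d + m2)⁻¹ *
                ∑ e : Fin d, (‖ψ (y + unitv d e)‖ₑ + ‖ψ (y - unitv d e)‖ₑ) ∂ρ :=
                lintegral_mono fun ψ => enorm_nbrMean_le hm2 ψ y
            _ = ENNReal.ofReal (2 * d + m2)⁻¹ * ∑ e : Fin d,
                (∫⁻ ψ, ‖ψ (y + unitv d e)‖ₑ ∂ρ + ∫⁻ ψ, ‖ψ (y - unitv d e)‖ₑ ∂ρ) := by
                rw [lintegral_const_mul _ (by fun_prop),
                  lintegral_finsetSum _ fun e _ => by fun_prop]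
                congr 1
                refine Finset.sum_congr rfl fun e _ => ?_
                rw [lintegral_add_left (by fun_prop)]
            _ ≤ ENNReal.ofReal (2 * d + m2)⁻¹ * ∑ _e : Fin d, (U + U) := by
                gcongr <;> exact hle _
            _ = _ := by
                simp only [Finset.sum_const, Finset.card_univ, Fintype.card_fin, nsmul_eq_mul]
                ring
  have hreal : U.toReal ≤ (2 * d + m2)⁻¹ * (2 * d * U.toReal) + K.toReal := by
    have htop : ENNReal.ofReal (2 * d + m2)⁻¹ * (2 * d * U) ≠ ⊤ := by
      finiteness
    have := ENNReal.toReal_mono (by finiteness) hrec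
    rw [ENNReal.toReal_add htop hK, ENNReal.toReal_mul, ENNReal.toReal_mul, ENNReal.toReal_mul,
      ENNReal.toReal_ofReal (by positivity)] at this
    simpa using this
  have hfin : U.toReal ≤ K.toReal * (2 * d + m2) / m2 := by
    rw [le_div_iff₀ hm2]
    have := mul_le_mul_of_nonneg_right hreal hs.le
    rw [add_mul, mul_comm ((2 * (d : ℝ) + m2)⁻¹), mul_assoc,
      inv_mul_cancel₀ hs.ne', mul_one] at this
    linarith
  calc ∫⁻ ψ, ‖ψ x‖ₑ ∂ρ ≤ U := hle x
    _ = ENNReal.ofReal U.toReal := (ENNReal.ofReal_toReal hUtop).symm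
    _ ≤ _ := ENNReal.ofReal_le_ofReal (by linarith)

theorem exists_isCompact_measure_compl_le {d N : ℕ} {C : ℝ} (hC : 0 < C) {ε : ℝ≥0∞}
    (hε : ε ≠ 0) :
    ∃ K : Set (ConfD d N), IsCompact K ∧
      ∀ ρ : Measure (ConfD d N), (∀ x, ∫⁻ ψ, ‖ψ x‖ₑ ∂ρ ≤ ENNReal.ofReal C) → ρ Kᶜ ≤ ε := by
  obtain ⟨δ, hδ0, hδ⟩ := ENNReal.exists_pos_sum_of_countable hε (SiteD d)
  have hr (x : SiteD d) : 0 < C / δ x := div_pos hC (NNReal.coe_pos.2 (hδ0 x))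
  refine ⟨Set.pi Set.univ fun x => Metric.closedBall 0 (C / δ x),
    isCompact_univ_pi fun x => isCompact_closedBall _ _, fun ρ hρ => ?_⟩
  have hsub : (Set.pi Set.univ fun x : SiteD d => Metric.closedBall (0 : Spin N) (C / δ x))ᶜ ⊆
      ⋃ x, {ψ : ConfD d N | ENNReal.ofReal (C / δ x) ≤ ‖ψ x‖ₑ} := by
    intro ψ hψ
    by_contra hcon
    refine hψ fun x _ => ?_
    rw [Set.mem_iUnion, not_exists] at hcon
    have h : ‖ψ x‖ₑ < ENNReal.ofReal (C / δ x) := not_le.1 (hcon x)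
    rw [← ofReal_norm, ENNReal.ofReal_lt_ofReal_iff (hr x)] at h
    exact mem_closedBall_zero_iff.2 h.le
  calc ρ _ ≤ ∑' x, ρ {ψ : ConfD d N | ENNReal.ofReal (C / δ x) ≤ ‖ψ x‖ₑ} :=
        (measure_mono hsub).trans (measure_iUnion_le _)
    _ ≤ ∑' x, (δ x : ℝ≥0∞) := by
        refine ENNReal.tsum_le_tsum fun x => ?_
        have hm : Measurable fun ψ : ConfD d N => ‖ψ x‖ₑ := by fun_prop
        refine (meas_ge_le_lintegral_div hm.aemeasurable
          (ENNReal.ofReal_pos.2 (hr x)).ne' ENNReal.ofReal_ne_top).trans ?_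
        refine ENNReal.div_le_of_le_mul ((hρ x).trans (le_of_eq ?_))
        rw [← ENNReal.ofReal_coe_nnreal, ← ENNReal.ofReal_mul (by positivity),
          mul_div_cancel₀ _ (NNReal.coe_pos.2 (hδ0 x)).ne']
    _ ≤ ε := hδ.le

/-- A sequence of probability measures with uniformly bounded first moments has a weakly
convergent subsequence. -/
theorem exists_subseq_tendsto_of_lintegral_enorm_le {d N : ℕ} {C : ℝ} (hC : 0 < C)
    (ρ : ℕ → ProbabilityMeasure (ConfD d N))
    (hρ : ∀ n x, ∫⁻ ψ, ‖ψ x‖ₑ ∂(ρ n : Measure (ConfD d N)) ≤ ENNReal.ofReal C) :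
    ∃ (μ : ProbabilityMeasure (ConfD d N)) (σ : ℕ → ℕ), StrictMono σ ∧
      Tendsto (ρ ∘ σ) atTop (nhds μ) := by
  have htight : IsTightMeasureSet
      {((μ : ProbabilityMeasure (ConfD d N)) : Measure (ConfD d N)) | μ ∈ Set.range ρ} := by
    rw [isTightMeasureSet_iff_exists_isCompact_measure_compl_le]
    intro ε hε
    obtain ⟨K, hK, hKle⟩ := exists_isCompact_measure_compl_le (d := d) (N := N) hC hε.ne'
    refine ⟨K, hK, ?_⟩
    rintro _ ⟨_, ⟨n, rfl⟩, rfl⟩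
    exact hKle _ (hρ n)
  have hcomp := isCompact_closure_of_isTightMeasureSet htight
  obtain ⟨μ, -, σ, hσ, hlim⟩ := hcomp.tendsto_subseq fun n => subset_closure ⟨n, rfl⟩
  exact ⟨μ, σ, hσ, hlim⟩

/-- The normalisation of the single-site Gibbs weight. -/
def ssNorm (d N : ℕ) (m2 : ℝ) (I : Set (Spin N)) (x : SiteD d) (ψ : ConfD d N) : ℝ :=
  ∫ γ, ssWeight d N m2 I ψ x γ ∂(volume : Measure (Spin N))

/-- The conditional expectation of `F` when the spin at `x` is redrawn from its Gibbs law. -/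
def ssMean {d N : ℕ} (m2 : ℝ) (I : Set (Spin N)) (x : SiteD d) (F : ConfD d N → ℝ)
    (ψ : ConfD d N) : ℝ :=
  (∫ γ, ssWeight d N m2 I ψ x γ * F (Function.update ψ x γ) ∂(volume : Measure (Spin N))) /
    ssNorm d N m2 I x ψ

theorem ssWeight_nonneg {d N : ℕ} (m2 : ℝ) (I : Set (Spin N)) (ψ : ConfD d N) (x : SiteD d)
    (γ : Spin N) : 0 ≤ ssWeight d N m2 I ψ x γ := by
  unfold ssWeight
  split_ifs
  · exact le_rfl
  · exact (Real.exp_pos _).le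

theorem ssWeight_le {d N : ℕ} {m2 : ℝ} (hm2 : 0 < m2) (I : Set (Spin N)) {ψ : ConfD d N}
    {x : SiteD d} {M : ℝ} (hM : ‖nbrSum ψ x‖ ≤ M) (γ : Spin N) :
    ssWeight d N m2 I ψ x γ ≤
      Real.exp (M ^ 2 / (2 * d + m2)) * Real.exp (-((2 * d + m2) / 4) * ‖γ‖ ^ 2) := by
  have hs : (0 : ℝ) < 2 * d + m2 := by positivity
  unfold ssWeight
  split_ifs
  · positivity
  · refine le_trans (Real.exp_le_exp.2 ?_) (exp_neg_sq_add_le hs M ‖γ‖)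
    have := real_inner_le_norm γ (nbrSum ψ x)
    have := mul_le_mul_of_nonneg_left hM (norm_nonneg γ)
    linarith

theorem measurable_ssWeight {d N : ℕ} (m2 : ℝ) {I : Set (Spin N)} (hI : MeasurableSet I)
    (x : SiteD d) :
    Measurable fun z : ConfD d N × Spin N => ssWeight d N m2 I z.1 x z.2 := by
  unfold ssWeight
  refine Measurable.ite (measurable_snd hI) measurable_const ?_
  have := (continuous_nbrSum (d := d) (N := N) x).measurable
  fun_prop

theorem ssWeight_nbrMean_add {d N : ℕ} {m2 : ℝ} (hm2 : 0 < m2) (I : Set (Spin N))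
    (ψ : ConfD d N) (x : SiteD d) (v : Spin N) :
    ssWeight d N m2 I ψ x (nbrMean m2 ψ x + v) =
      Real.exp (‖nbrSum ψ x‖ ^ 2 / (2 * (2 * d + m2))) *
        (if nbrMean m2 ψ x + v ∈ I then 0 else Real.exp (-((2 * d + m2) / 2) * ‖v‖ ^ 2)) := by
  have hs : (0 : ℝ) < 2 * d + m2 := by positivity
  unfold ssWeight
  split_ifs
  · simp
  · rw [← Real.exp_add]
    congr 1
    rw [norm_add_sq_real, inner_add_left, nbrMean, inner_smul_left, inner_smul_left, norm_smul,
      real_inner_self_eq_norm_sq, real_inner_comm v]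
    simp only [map_inv₀, conj_trivial, norm_inv, Real.norm_of_nonneg hs.le]
    field_simp
    ring

theorem admissible_of_mem {d N : ℕ} (m2 : ℝ) {V : Set (SiteD d)} (I : Set (Spin N))
    {x : SiteD d} (hx : x ∈ V) (ψ : ConfD d N) :
    admissible m2 V I x ψ = {v | nbrMean m2 ψ x + v ∉ I} := by
  ext v; simp [admissible, hx]

theorem ssNorm_eq {d N : ℕ} {m2 : ℝ} (hm2 : 0 < m2) {I : Set (Spin N)} (hI : MeasurableSet I)
    {V : Set (SiteD d)} {x : SiteD d} (hx : x ∈ V) (ψ : ConfD d N) :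
    ssNorm d N m2 I x ψ =
      Real.exp (‖nbrSum ψ x‖ ^ 2 / (2 * (2 * d + m2))) *
        ((gaussNoise N (2 * d + m2)).real (admissible m2 V I x ψ) *
          ∫ v : Spin N, Real.exp (-((2 * d + m2) / 2) * ‖v‖ ^ 2)) := by
  have hs : (0 : ℝ) < 2 * d + m2 := by positivity
  have hA := measurableSet_admissible m2 V hI x ψ
  rw [ssNorm, ← integral_add_left_eq_self _ (nbrMean m2 ψ x)]
  simp only [ssWeight_nbrMean_add hm2]
  rw [integral_const_mul]
  congr 1
  have hint := integrable_exp_neg_mul_sq_norm N (half_pos hs)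
  have hpos : 0 < ∫ v : Spin N, Real.exp (-((2 * d + m2) / 2) * ‖v‖ ^ 2) :=
    integral_exp_pos hint
  have h1 : (gaussNoise N (2 * d + m2)).real (admissible m2 V I x ψ) =
      ∫ v in admissible m2 V I x ψ, Real.exp (-((2 * d + m2) / 2) * ‖v‖ ^ 2) /
        ∫ v : Spin N, Real.exp (-((2 * d + m2) / 2) * ‖v‖ ^ 2) := by
    rw [Measure.real, gaussNoise, tilted_apply_eq_ofReal_integral' _ hA,
      ENNReal.toReal_ofReal (integral_nonneg fun v => by positivity)]
  rw [h1, integral_div, div_mul_cancel₀ _ hpos.ne', ← integral_indicator hA]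
  congr 1 with v
  simp only [Set.indicator, admissible_of_mem m2 I hx]
  by_cases h : nbrMean m2 ψ x + v ∈ I <;> simp [h]

theorem ssNorm_pos {d N : ℕ} (hN : 0 < N) {m2 : ℝ} (hm2 : 0 < m2) (R : ℝ) (x : SiteD d)
    (ψ : ConfD d N) : 0 < ssNorm d N m2 (Metric.ball (0 : Spin N) R) x ψ := by
  have hs : (0 : ℝ) < 2 * d + m2 := by positivity
  have hprob := isProbabilityMeasure_gaussNoise N hs
  obtain ⟨p, hp0, hp⟩ := exists_gaussNoise_lower_bound hN hs R
  rw [ssNorm_eq hm2 measurableSet_ball (Set.mem_univ x)]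
  have h1 : 0 < (gaussNoise N (2 * d + m2)).real
      (admissible m2 Set.univ (Metric.ball (0 : Spin N) R) x ψ) :=
    ENNReal.toReal_pos (hp0.trans_le (le_gaussNoise_admissible _ hp x ψ)).ne' (measure_ne_top _ _)
  have h2 : 0 < ∫ v : Spin N, Real.exp (-((2 * d + m2) / 2) * ‖v‖ ^ 2) :=
    integral_exp_pos (integrable_exp_neg_mul_sq_norm N (half_pos hs))
  positivity

theorem ofReal_ssWeight_div {d N : ℕ} (hN : 0 < N) {m2 : ℝ} (hm2 : 0 < m2) (R : ℝ)
    {V : Set (SiteD d)} {x : SiteD d} (hx : x ∈ V) (ψ : ConfD d N) (v : Spin N) :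
    ENNReal.ofReal (ssWeight d N m2 (Metric.ball (0 : Spin N) R) ψ x (nbrMean m2 ψ x + v) /
        ssNorm d N m2 (Metric.ball (0 : Spin N) R) x ψ) =
      (gaussNoise N (2 * d + m2) (admissible m2 V (Metric.ball (0 : Spin N) R) x ψ))⁻¹ *
        (admissible m2 V (Metric.ball (0 : Spin N) R) x ψ).indicator
          (fun v => ENNReal.ofReal (Real.exp (-((2 * d + m2) / 2) * ‖v‖ ^ 2) /
            ∫ v : Spin N, Real.exp (-((2 * d + m2) / 2) * ‖v‖ ^ 2))) v := by
  have hs : (0 : ℝ) < 2 * d + m2 := by positivity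
  have hprob := isProbabilityMeasure_gaussNoise N hs
  obtain ⟨p, hp0, hp⟩ := exists_gaussNoise_lower_bound hN hs R
  have hνpos := (hp0.trans_le (le_gaussNoise_admissible (m2 := m2) V hp x ψ)).ne'
  have h1 : 0 < (gaussNoise N (2 * d + m2)).real
      (admissible m2 V (Metric.ball (0 : Spin N) R) x ψ) :=
    ENNReal.toReal_pos hνpos (measure_ne_top _ _)
  have h2 : 0 < ∫ v : Spin N, Real.exp (-((2 * d + m2) / 2) * ‖v‖ ^ 2) :=
    integral_exp_pos (integrable_exp_neg_mul_sq_norm N (half_pos hs))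
  rw [ssNorm_eq hm2 measurableSet_ball hx, ssWeight_nbrMean_add hm2]
  by_cases h : nbrMean m2 ψ x + v ∈ Metric.ball (0 : Spin N) R
  · have hv : v ∉ admissible m2 V (Metric.ball (0 : Spin N) R) x ψ := by
      rw [admissible_of_mem m2 _ hx]; exact not_not.2 h
    rw [Set.indicator_of_notMem hv, if_pos h]
    simp
  · have hv : v ∈ admissible m2 V (Metric.ball (0 : Spin N) R) x ψ := by
      rw [admissible_of_mem m2 _ hx]; exact h
    rw [if_neg h, Set.indicator_of_mem hv, mul_div_mul_left _ _ (Real.exp_pos _).ne',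
      mul_comm ((gaussNoise N (2 * d + m2)).real _), ← div_div,
      ENNReal.ofReal_div_of_pos h1, Measure.real, ENNReal.ofReal_toReal (measure_ne_top _ _),
      div_eq_mul_inv, mul_comm]

theorem lintegral_ssWeight {d N : ℕ} (hN : 0 < N) {m2 : ℝ} (hm2 : 0 < m2) (R : ℝ)
    {V : Set (SiteD d)} {x : SiteD d} (hx : x ∈ V) (ψ : ConfD d N)
    {F : ConfD d N → ℝ≥0∞} (hF : Measurable F) :
    ∫⁻ γ, ENNReal.ofReal (ssWeight d N m2 (Metric.ball (0 : Spin N) R) ψ x γ /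
        ssNorm d N m2 (Metric.ball (0 : Spin N) R) x ψ) * F (Function.update ψ x γ) =
      (gaussNoise N (2 * d + m2) (admissible m2 V (Metric.ball (0 : Spin N) R) x ψ))⁻¹ *
        ∫⁻ v in admissible m2 V (Metric.ball (0 : Spin N) R) x ψ, F (resample m2 x (ψ, v))
          ∂(gaussNoise N (2 * d + m2)) := by
  have hA := measurableSet_admissible m2 V (measurableSet_ball (x := (0 : Spin N)) (ε := R)) x ψ
  have hFm : Measurable fun v => F (resample m2 x (ψ, v)) :=
    hF.comp ((measurable_resample m2 x).comp measurable_prodMk_left)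
  rw [← lintegral_add_left_eq_self _ (nbrMean m2 ψ x)]
  simp only [ofReal_ssWeight_div hN hm2 R hx, mul_assoc]
  rw [lintegral_const_mul _ (by
    refine Measurable.mul (Measurable.indicator (by fun_prop) hA) hFm)]
  congr 1
  rw [gaussNoise, setLIntegral_tilted' _ _ hA, ← lintegral_indicator hA]
  refine lintegral_congr fun v => ?_
  by_cases hv : v ∈ admissible m2 V (Metric.ball (0 : Spin N) R) x ψ <;>
    simp [Set.indicator, hv, resample]

/-- The law obtained from `μ` by redrawing the spin at `x` from its Gibbs law. -/
def glauber {d N : ℕ} (m2 : ℝ) (I : Set (Spin N)) (x : SiteD d) (μ : Measure (ConfD d N)) :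
    Measure (ConfD d N) :=
  ((μ.prod (volume : Measure (Spin N))).withDensity fun z =>
    ENNReal.ofReal (ssWeight d N m2 I z.1 x z.2 / ssNorm d N m2 I x z.1)).map
      fun z => Function.update z.1 x z.2

theorem measurable_update_pair {d N : ℕ} (x : SiteD d) :
    Measurable fun z : ConfD d N × Spin N => Function.update z.1 x z.2 := by
  refine measurable_pi_lambda _ fun y => ?_
  by_cases hy : y = x
  · subst hy; simpa using measurable_snd
  · simp only [Function.update_of_ne hy]
    exact (measurable_pi_apply y).comp measurable_fst

theorem continuous_integral_ssWeight_mul {d N : ℕ} {m2 : ℝ} (hm2 : 0 < m2) {I : Set (Spin N)}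
    (hI : MeasurableSet I) (x : SiteD d) {F : ConfD d N → ℝ} (hF : Continuous F) {C : ℝ}
    (hC : ∀ ψ, |F ψ| ≤ C) :
    Continuous fun ψ => ∫ γ, ssWeight d N m2 I ψ x γ * F (Function.update ψ x γ)
      ∂(volume : Measure (Spin N)) := by
  have hs : (0 : ℝ) < 2 * d + m2 := by positivity
  rw [continuous_iff_continuousAt]
  intro ψ₀
  set M := ‖nbrSum ψ₀ x‖ + 1
  have hC0 : 0 ≤ C := (abs_nonneg _).trans (hC ψ₀)
  refine continuousAt_of_dominated
    (bound := fun γ => Real.exp (M ^ 2 / (2 * d + m2)) *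
      Real.exp (-((2 * d + m2) / 4) * ‖γ‖ ^ 2) * C) ?_ ?_ ?_ ?_
  · refine Eventually.of_forall fun ψ => Measurable.aestronglyMeasurable ?_
    exact ((measurable_ssWeight m2 hI x).comp measurable_prodMk_left).mul
      (hF.measurable.comp ((measurable_update_pair x).comp measurable_prodMk_left))
  · have hnhds : ∀ᶠ ψ in nhds ψ₀, ‖nbrSum ψ x‖ < M :=
      (continuous_nbrSum x).norm.continuousAt.eventually_lt_const (lt_add_one _)
    filter_upwards [hnhds] with ψ hψ
    refine ae_of_all _ fun γ => ?_
    rw [norm_mul, Real.norm_of_nonneg (ssWeight_nonneg m2 I ψ x γ)]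
    exact mul_le_mul (ssWeight_le hm2 I hψ.le γ) (hC _) (abs_nonneg _) (by positivity)
  · exact ((integrable_exp_neg_mul_sq_norm N (by positivity : 0 < (2 * d + m2) / 4)).const_mul _).mul_const _
  · refine ae_of_all _ fun γ => Continuous.continuousAt ?_
    refine Continuous.mul ?_ (hF.comp (continuous_id.update x continuous_const))
    unfold ssWeight
    have := continuous_nbrSum (d := d) (N := N) x
    by_cases hγ : γ ∈ I
    · simpa [hγ] using continuous_const
    · simp only [hγ, if_false]
      fun_prop

theorem continuous_ssNorm {d N : ℕ} {m2 : ℝ} (hm2 : 0 < m2) {I : Set (Spin N)}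
    (hI : MeasurableSet I) (x : SiteD d) :
    Continuous fun ψ : ConfD d N => ssNorm d N m2 I x ψ := by
  simpa [ssNorm] using continuous_integral_ssWeight_mul hm2 hI x
    (F := fun _ => 1) continuous_const (C := 1) (by simp)

theorem integrable_ssWeight {d N : ℕ} {m2 : ℝ} (hm2 : 0 < m2) {I : Set (Spin N)}
    (hI : MeasurableSet I) (x : SiteD d) (ψ : ConfD d N) :
    Integrable (fun γ => ssWeight d N m2 I ψ x γ) := by
  have hs : (0 : ℝ) < 2 * d + m2 := by positivity
  refine ((integrable_exp_neg_mul_sq_norm N (by positivity : 0 < (2 * d + m2) / 4)).const_mul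
      (Real.exp (‖nbrSum ψ x‖ ^ 2 / (2 * d + m2)))).mono'
    ((measurable_ssWeight m2 hI x).comp measurable_prodMk_left).aestronglyMeasurable
    (ae_of_all _ fun γ => ?_)
  rw [Real.norm_of_nonneg (ssWeight_nonneg m2 I ψ x γ)]
  exact ssWeight_le hm2 I le_rfl γ

theorem measurable_ssDensity {d N : ℕ} {m2 : ℝ} (hm2 : 0 < m2) {I : Set (Spin N)}
    (hI : MeasurableSet I) (x : SiteD d) :
    Measurable fun z : ConfD d N × Spin N =>
      ENNReal.ofReal (ssWeight d N m2 I z.1 x z.2 / ssNorm d N m2 I x z.1) :=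
  ((measurable_ssWeight m2 hI x).div
    ((continuous_ssNorm hm2 hI x).measurable.comp measurable_fst)).ennreal_ofReal

theorem lintegral_glauber {d N : ℕ} {m2 : ℝ} (hm2 : 0 < m2) {I : Set (Spin N)}
    (hI : MeasurableSet I) (x : SiteD d) (μ : Measure (ConfD d N)) [SFinite μ]
    {F : ConfD d N → ℝ≥0∞} (hF : Measurable F) :
    ∫⁻ ψ, F ψ ∂(glauber m2 I x μ) =
      ∫⁻ ψ, (∫⁻ γ, ENNReal.ofReal (ssWeight d N m2 I ψ x γ / ssNorm d N m2 I x ψ) *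
        F (Function.update ψ x γ)) ∂μ := by
  have hFu : Measurable fun z : ConfD d N × Spin N => F (Function.update z.1 x z.2) :=
    hF.comp (measurable_update_pair x)
  rw [glauber, lintegral_map hF (measurable_update_pair x),
    lintegral_withDensity_eq_lintegral_mul _ (measurable_ssDensity hm2 hI x) hFu,
    lintegral_prod _ ((measurable_ssDensity hm2 hI x).mul hFu).aemeasurable]
  rfl

theorem isProbabilityMeasure_glauber {d N : ℕ} (hN : 0 < N) {m2 : ℝ} (hm2 : 0 < m2) (R : ℝ)
    (x : SiteD d) (μ : Measure (ConfD d N)) [IsProbabilityMeasure μ] :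
    IsProbabilityMeasure (glauber m2 (Metric.ball (0 : Spin N) R) x μ) := by
  constructor
  rw [← lintegral_one, lintegral_glauber hm2 measurableSet_ball x μ measurable_const]
  have h (ψ : ConfD d N) : ∫⁻ γ, ENNReal.ofReal (ssWeight d N m2 (Metric.ball (0 : Spin N) R) ψ x γ
      / ssNorm d N m2 (Metric.ball (0 : Spin N) R) x ψ) * 1 = 1 := by
    have hpos := ssNorm_pos hN hm2 R x ψ
    simp only [mul_one]
    rw [← ofReal_integral_eq_lintegral_ofReal
      ((integrable_ssWeight hm2 measurableSet_ball x ψ).div_const _)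
      (ae_of_all _ fun γ => div_nonneg (ssWeight_nonneg m2 _ ψ x γ) hpos.le), integral_div]
    change ENNReal.ofReal (ssNorm d N m2 _ x ψ / _) = 1
    rw [div_self hpos.ne', ENNReal.ofReal_one]
  refine (lintegral_congr h).trans ?_
  simp

theorem integral_glauber {d N : ℕ} (hN : 0 < N) {m2 : ℝ} (hm2 : 0 < m2) (R : ℝ)
    (x : SiteD d) (μ : Measure (ConfD d N)) [IsProbabilityMeasure μ]
    {F : ConfD d N → ℝ} (hF : Measurable F) {C : ℝ} (hC : ∀ ψ, |F ψ| ≤ C) :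
    ∫ ψ, F ψ ∂(glauber m2 (Metric.ball (0 : Spin N) R) x μ) =
      ∫ ψ, ssMean m2 (Metric.ball (0 : Spin N) R) x F ψ ∂μ := by
  have hI : MeasurableSet (Metric.ball (0 : Spin N) R) := measurableSet_ball
  have hprob := isProbabilityMeasure_glauber hN hm2 R x μ
  have hum := measurable_update_pair (d := d) (N := N) x
  have hq := measurable_ssDensity (d := d) hm2 hI x
  have hint : Integrable F (glauber m2 (Metric.ball (0 : Spin N) R) x μ) :=
    Integrable.of_bound hF.aestronglyMeasurable C (ae_of_all _ hC)
  have hint2 := (integrable_map_measure hF.aestronglyMeasurable hum.aemeasurable).1 hint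
  rw [integrable_withDensity_iff_integrable_smul' hq (ae_of_all _ fun _ => by simp)] at hint2
  simp only [Function.comp_apply] at hint2
  rw [glauber, integral_map hum.aemeasurable hF.aestronglyMeasurable,
    integral_withDensity_eq_integral_toReal_smul hq (ae_of_all _ fun _ => by simp),
    integral_prod _ hint2]
  refine integral_congr_ae (ae_of_all _ fun ψ => ?_)
  have hpos := ssNorm_pos hN hm2 R x ψ
  simp only [ssMean, smul_eq_mul]
  rw [← integral_div]
  refine integral_congr_ae (ae_of_all _ fun γ => ?_)
  simp only
  rw [ENNReal.toReal_ofReal (div_nonneg (ssWeight_nonneg m2 _ ψ x γ) hpos.le)]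
  ring

theorem abs_ssMean_le {d N : ℕ} (hN : 0 < N) {m2 : ℝ} (hm2 : 0 < m2) (R : ℝ)
    (x : SiteD d) {F : ConfD d N → ℝ} {C : ℝ} (hC : ∀ ψ, |F ψ| ≤ C) (ψ : ConfD d N) :
    |ssMean m2 (Metric.ball (0 : Spin N) R) x F ψ| ≤ C := by
  have hpos := ssNorm_pos hN hm2 R x ψ
  rw [ssMean, abs_div, abs_of_pos hpos, div_le_iff₀ hpos, mul_comm C, ssNorm,
    ← integral_mul_const, ← Real.norm_eq_abs]
  refine norm_integral_le_of_norm_le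
    ((integrable_ssWeight hm2 measurableSet_ball x ψ).mul_const _) (ae_of_all _ fun γ => ?_)
  rw [norm_mul, Real.norm_of_nonneg (ssWeight_nonneg m2 _ ψ x γ)]
  exact mul_le_mul_of_nonneg_left (hC _) (ssWeight_nonneg m2 _ ψ x γ)

/-- The single-site conditional expectation of a bounded continuous observable. -/
def ssMeanBCF {d N : ℕ} (hN : 0 < N) {m2 : ℝ} (hm2 : 0 < m2) (R : ℝ) (x : SiteD d)
    (f : BoundedContinuousFunction (ConfD d N) ℝ) : BoundedContinuousFunction (ConfD d N) ℝ :=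
  BoundedContinuousFunction.ofNormedAddCommGroup
    (ssMean m2 (Metric.ball (0 : Spin N) R) x f)
    ((continuous_integral_ssWeight_mul hm2 measurableSet_ball x f.continuous
      f.norm_coe_le_norm).div (continuous_ssNorm hm2 measurableSet_ball x)
        fun ψ => (ssNorm_pos hN hm2 R x ψ).ne')
    ‖f‖ (abs_ssMean_le hN hm2 R x f.norm_coe_le_norm)

/-- The single-site DLR equation for the conditioned field, inside the conditioned region. -/
theorem glauber_cond {d N : ℕ} (hN : 0 < N) {m2 : ℝ} (hm2 : 0 < m2) (R : ℝ)
    {μ : Measure (ConfD d N)} [IsProbabilityMeasure μ] {x : SiteD d}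
    (hres : (μ.prod (gaussNoise N (2 * d + m2))).map (resample m2 x) = μ)
    {V : Set (SiteD d)} (hx : x ∈ V) :
    glauber m2 (Metric.ball (0 : Spin N) R) x
        (ProbabilityTheory.cond μ (avoidsD V (Metric.ball (0 : Spin N) R))) =
      ProbabilityTheory.cond μ (avoidsD V (Metric.ball (0 : Spin N) R)) := by
  have hs : (0 : ℝ) < 2 * d + m2 := by positivity
  have hprob := isProbabilityMeasure_gaussNoise N hs
  obtain ⟨p, hp0, hp⟩ := exists_gaussNoise_lower_bound hN hs R
  set I := Metric.ball (0 : Spin N) R with hIdef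
  have hI : MeasurableSet I := measurableSet_ball
  refine Measure.ext_of_lintegral _ fun F hF => ?_
  rw [lintegral_glauber hm2 hI x _ hF, ProbabilityTheory.cond, lintegral_smul_measure,
    lintegral_smul_measure]
  congr 1
  have hB : Measurable fun ψ : ConfD d N => ∫⁻ γ, ENNReal.ofReal (ssWeight d N m2 I ψ x γ /
      ssNorm d N m2 I x ψ) * F (Function.update ψ x γ) :=
    ((measurable_ssDensity hm2 hI x).mul
      (hF.comp (measurable_update_pair x))).lintegral_prod_right'
  rw [setLIntegral_resample hm2 hres V hI hF, setLIntegral_resample hm2 hres V hI hB]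
  refine lintegral_congr fun ψ => ?_
  have hadm (v : Spin N) : admissible m2 V I x (resample m2 x (ψ, v)) =
      admissible m2 V I x ψ := by
    simp only [admissible, resample, nbrMean_update]
  have hidem (v w : Spin N) : resample m2 x (resample m2 x (ψ, v), w) = resample m2 x (ψ, w) := by
    simp only [resample, nbrMean_update, Function.update_idem]
  simp only [hIdef, lintegral_ssWeight hN hm2 R hx _ hF]
  simp only [← hIdef, hadm, hidem]
  have hpos : gaussNoise N (2 * d + m2) (admissible m2 V I x ψ) ≠ 0 :=
    (hp0.trans_le (le_gaussNoise_admissible V hp x ψ)).ne'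
  rw [lintegral_const, Measure.restrict_apply_univ, mul_comm, ← mul_assoc,
    ENNReal.mul_inv_cancel hpos (measure_ne_top _ _), one_mul]

theorem isProbabilityMeasure_of_tendsto {d N : ℕ} {ρ : ℕ → Measure (ConfD d N)}
    [∀ k, IsProbabilityMeasure (ρ k)] {ν : Measure (ConfD d N)}
    (hlim : ∀ f : BoundedContinuousFunction (ConfD d N) ℝ,
      Tendsto (fun k => ∫ ψ, f ψ ∂(ρ k)) atTop (nhds (∫ ψ, f ψ ∂ν))) :
    IsProbabilityMeasure ν := by
  have h := hlim (BoundedContinuousFunction.const _ 1)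
  simp only [BoundedContinuousFunction.const_apply, integral_const, probReal_univ, smul_eq_mul,
    mul_one] at h
  exact isProbabilityMeasure_iff_real.2 (tendsto_nhds_unique h tendsto_const_nhds)

theorem glauber_eq_of_tendsto {d N : ℕ} (hN : 0 < N) {m2 : ℝ} (hm2 : 0 < m2) (R : ℝ)
    {ρ : ℕ → Measure (ConfD d N)} [∀ k, IsProbabilityMeasure (ρ k)] {ν : Measure (ConfD d N)}
    [IsProbabilityMeasure ν]
    (hlim : ∀ f : BoundedContinuousFunction (ConfD d N) ℝ,
      Tendsto (fun k => ∫ ψ, f ψ ∂(ρ k)) atTop (nhds (∫ ψ, f ψ ∂ν))) {x : SiteD d}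
    (hx : ∀ᶠ k in atTop, glauber m2 (Metric.ball (0 : Spin N) R) x (ρ k) = ρ k) :
    glauber m2 (Metric.ball (0 : Spin N) R) x ν = ν := by
  have := isProbabilityMeasure_glauber hN hm2 R x ν
  refine ext_of_forall_integral_eq_of_IsFiniteMeasure fun f => ?_
  rw [integral_glauber hN hm2 R x ν f.continuous.measurable f.norm_coe_le_norm]
  refine tendsto_nhds_unique (hlim (ssMeanBCF hN hm2 R x f)) ((hlim f).congr' ?_)
  filter_upwards [hx] with k hk
  conv_lhs => rw [← hk]
  rw [integral_glauber hN hm2 R x (ρ k) f.continuous.measurable f.norm_coe_le_norm]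
  rfl

theorem lintegral_enorm_le_of_tendsto {d N : ℕ}
    {ρ : ℕ → Measure (ConfD d N)} [∀ k, IsProbabilityMeasure (ρ k)] {ν : Measure (ConfD d N)}
    [IsProbabilityMeasure ν]
    (hlim : ∀ f : BoundedContinuousFunction (ConfD d N) ℝ,
      Tendsto (fun k => ∫ ψ, f ψ ∂(ρ k)) atTop (nhds (∫ ψ, f ψ ∂ν))) {x : SiteD d} {C : ℝ≥0∞}
    (hC : ∀ k, ∫⁻ ψ, ‖ψ x‖ₑ ∂(ρ k) ≤ C) : ∫⁻ ψ, ‖ψ x‖ₑ ∂ν ≤ C := by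
  let P (k : ℕ) : ProbabilityMeasure (ConfD d N) := ⟨ρ k, inferInstance⟩
  let Q : ProbabilityMeasure (ConfD d N) := ⟨ν, inferInstance⟩
  have htend : Tendsto P atTop (nhds Q) :=
    ProbabilityMeasure.tendsto_iff_forall_integral_tendsto.2 hlim
  have h := lintegral_le_liminf_lintegral_of_forall_isOpen_measure_le_liminf_measure
    (μ := ν) (μs := ρ) (f := fun ψ => ‖ψ x‖) (by fun_prop) (fun ψ => norm_nonneg _)
    fun G hG => ProbabilityMeasure.le_liminf_measure_open_of_tendsto htend hG
  simp only [ofReal_norm] at h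
  refine h.trans ((liminf_le_liminf (Eventually.of_forall hC)).trans ?_)
  simp

theorem measure_exists_mem_of_glauber_eq {d N : ℕ} {m2 : ℝ} (hm2 : 0 < m2) {I : Set (Spin N)}
    (hI : MeasurableSet I) {ν : Measure (ConfD d N)} [IsProbabilityMeasure ν]
    (hν : ∀ x, glauber m2 I x ν = ν) : ν {ψ | ∃ x, ψ x ∈ I} = 0 := by
  have hunion : {ψ : ConfD d N | ∃ x, ψ x ∈ I} = ⋃ x, (fun ψ => ψ x) ⁻¹' I := by
    ext ψ; simp
  rw [hunion, measure_iUnion_null_iff]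
  intro x
  have hA : MeasurableSet ((fun ψ : ConfD d N => ψ x) ⁻¹' I) := measurable_pi_apply x hI
  rw [← hν x, ← lintegral_indicator_one hA,
    lintegral_glauber hm2 hI x ν (measurable_one.indicator hA)]
  have h (ψ : ConfD d N) (γ : Spin N) :
      ENNReal.ofReal (ssWeight d N m2 I ψ x γ / ssNorm d N m2 I x ψ) *
        ((fun ψ : ConfD d N => ψ x) ⁻¹' I).indicator 1 (Function.update ψ x γ) = 0 := by
    by_cases hγ : γ ∈ I
    · simp [ssWeight, hγ]
    · simp [Set.indicator, hγ]
  simp [h]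

/-- Weak limits along volumes exhausting the lattice of conditioned fields with uniformly bounded
first moments are Gibbs measures with uniformly bounded first moments. -/
theorem mem_GibbsOne_of_tendsto {d N : ℕ} (hN : 0 < N) {m2 : ℝ} (hm2 : 0 < m2) (R : ℝ)
    {μ : Measure (ConfD d N)} [IsProbabilityMeasure μ]
    (hres : ∀ x, (μ.prod (gaussNoise N (2 * d + m2))).map (resample m2 x) = μ) {C : ℝ}
    (hC : ∀ n x, ∫⁻ ψ, ‖ψ x‖ₑ
      ∂(ProbabilityTheory.cond μ (avoidsD (LamD d n) (Metric.ball (0 : Spin N) R))) ≤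
        ENNReal.ofReal C)
    {σ : ℕ → ℕ} (hσ : StrictMono σ) {ν : Measure (ConfD d N)}
    (hlim : ∀ f : BoundedContinuousFunction (ConfD d N) ℝ,
      Tendsto (fun k : ℕ => ∫ ψ, f ψ
        ∂(ProbabilityTheory.cond μ (avoidsD (LamD d (σ k)) (Metric.ball (0 : Spin N) R))))
          atTop (nhds (∫ ψ, f ψ ∂ν))) :
    ν ∈ GibbsOne d N m2 (Metric.ball (0 : Spin N) R) := by
  have hcond (k : ℕ) : IsProbabilityMeasure
      (ProbabilityTheory.cond μ (avoidsD (LamD d (σ k)) (Metric.ball (0 : Spin N) R))) :=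
    ProbabilityTheory.cond_isProbabilityMeasure
      (measure_avoidsD_pos hN hm2 R hres (LamD_finite d _)).ne'
  have hprob := isProbabilityMeasure_of_tendsto hlim
  have hglauber (x : SiteD d) : glauber m2 (Metric.ball (0 : Spin N) R) x ν = ν := by
    refine glauber_eq_of_tendsto hN hm2 R hlim ?_
    obtain ⟨n₀, hn₀⟩ := exists_mem_LamD x
    filter_upwards [eventually_ge_atTop n₀] with k hk
    exact glauber_cond hN hm2 R (hres x) (hn₀ _ (hk.trans (hσ.id_le k)))
  refine ⟨⟨hprob, measure_exists_mem_of_glauber_eq hm2 measurableSet_ball hglauber, ?_⟩,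
    C, fun x => lintegral_enorm_le_of_tendsto hlim fun k => hC _ x⟩
  rintro x F hF ⟨B, hB⟩
  conv_lhs => rw [← hglauber x]
  exact integral_glauber hN hm2 R x ν hF hB

/-- **Proposition (existence of infinite-volume measures for the conditioned massive GFF).**
For `d ≥ 2`, `m² > 0` and `I = B^N(0,R)`, the sequence `(P_{ℤ^d,m²}[· | Ω^I_{Λ_n}])_n` is
tight, every subsequential weak limit lies in `𝒢₁(𝒰^I)`, `𝒢₁(𝒰^I) ≠ ∅`, and the conditioned
first moments are uniformly bounded. -/
theorem conditioned_massive_gff_existence (d N : ℕ) (hd : 2 ≤ d) (hN : 0 < N)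
    (m2 R : ℝ) (hm2 : 0 < m2) (hR : 0 < R)
    (g : SiteD d → SiteD d → ℝ) (hg : IsGreen d m2 g)
    (μG : Measure (ConfD d N)) (hμG : IsMassiveGFF d N g μG) :
    (∀ ε : ℝ, 0 < ε → ∃ K : Set (ConfD d N), IsCompact K ∧
      ∀ n : ℕ,
        ProbabilityTheory.cond μG (avoidsD (LamD d n) (Metric.ball (0 : Spin N) R)) Kᶜ ≤
          ENNReal.ofReal ε) ∧
    (∀ (μ : Measure (ConfD d N)) (σ : ℕ → ℕ), StrictMono σ →
      (∀ f : BoundedContinuousFunction (ConfD d N) ℝ,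
        Tendsto
          (fun k : ℕ => ∫ ψ, f ψ
            ∂(ProbabilityTheory.cond μG
                (avoidsD (LamD d (σ k)) (Metric.ball (0 : Spin N) R))))
          atTop (nhds (∫ ψ, f ψ ∂μ))) →
      μ ∈ GibbsOne d N m2 (Metric.ball (0 : Spin N) R)) ∧
    (GibbsOne d N m2 (Metric.ball (0 : Spin N) R)).Nonempty ∧
    ∃ C : ℝ, 0 < C ∧ ∀ x : SiteD d, ∀ n : ℕ,
      ∫⁻ ψ, ‖ψ x‖₊
          ∂(ProbabilityTheory.cond μG (avoidsD (LamD d n) (Metric.ball (0 : Spin N) R))) ≤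
        ENNReal.ofReal C := by
  have hprob : IsProbabilityMeasure μG := hμG.1
  have hres (x : SiteD d) := hμG.map_resample hN hm2 hg x
  obtain ⟨C, hC0, hC⟩ := exists_cond_lintegral_enorm_le hN hm2 R hres
    (hμG.exists_lintegral_enorm_le hg)
  have hCn (n : ℕ) (x : SiteD d) := hC (LamD d n) (LamD_finite d n) x
  have hcond (n : ℕ) : IsProbabilityMeasure
      (ProbabilityTheory.cond μG (avoidsD (LamD d n) (Metric.ball (0 : Spin N) R))) :=
    ProbabilityTheory.cond_isProbabilityMeasure
      (measure_avoidsD_pos hN hm2 R hres (LamD_finite d n)).ne'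
  refine ⟨fun ε hε => ?_, fun μ σ hσ hlim => mem_GibbsOne_of_tendsto hN hm2 R hres hCn hσ hlim,
    ?_, C, hC0, fun x n => hCn n x⟩
  · obtain ⟨K, hK, hKle⟩ := exists_isCompact_measure_compl_le (d := d) (N := N) hC0
      (ENNReal.ofReal_pos.2 hε).ne'
    exact ⟨K, hK, fun n => hKle _ (hCn n)⟩
  · obtain ⟨μ, σ, hσ, hlim⟩ := exists_subseq_tendsto_of_lintegral_enorm_le hC0
      (fun n => ⟨_, hcond n⟩) hCn
    exact ⟨μ, mem_GibbsOne_of_tendsto hN hm2 R hres hCn hσ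
      (ProbabilityMeasure.tendsto_iff_forall_integral_tendsto.1 hlim)⟩

end
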